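/- Let b ≥ 1 and d ≥ 1 be integers and let ℱ be a finite family of subsets of ℝ^d such that for every nonempty subfamily 𝒢 ⊆ ℱ, the intersection ⋂𝒢 has at most b path-connected components and the singular homology H_i(⋂𝒢; ℤ₂) vanishes for all 1 ≤ i ≤ ⌈d/2⌉−1. Then, if ⋂ℱ = ∅, there exists a subfamily 𝒢 ⊆ ℱ with at most b·∑_{j=0}^{d+1} C(b+1,2)^j elements and ⋂𝒢 = ∅. -/

import Mathlib

open CategoryTheory AlgebraicTopology

/-- Singular homology of a topological space with coefficients in a commutative ring `R`. -/
noncomputable def SingularHomology (R : Type) [CommRing R]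
    (X : Type) [TopologicalSpace X] (n : ℕ) : ModuleCat R :=
  (((alternatingFaceMapComplex (ModuleCat R)).obj
      (((SimplicialObject.whiskering _ _).obj (ModuleCat.free R)).obj
        (TopCat.toSSet.obj (TopCat.of X)))).homology n)

/-- The `i`-th face of a singular simplex. -/
noncomputable def singFace {X : Type*} [TopologicalSpace X] {n : ℕ} (i : Fin (n + 2))
    (s : C(stdSimplex ℝ (Fin (n + 2)), X)) : C(stdSimplex ℝ (Fin (n + 1)), X) :=
  s.comp ⟨stdSimplex.map i.succAbove, stdSimplex.continuous_map _⟩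

/-- The boundary operator on singular chains with `ℤ₂` coefficients. -/
noncomputable def singBd (X : Type*) [TopologicalSpace X] (n : ℕ) :
    (C(stdSimplex ℝ (Fin (n + 2)), X) →₀ ZMod 2) →ₗ[ZMod 2]
      (C(stdSimplex ℝ (Fin (n + 1)), X) →₀ ZMod 2) :=
  ∑ i : Fin (n + 2), Finsupp.lmapDomain _ _ (singFace i)

theorem signed_sum_apply {M N : ModuleCat (ZMod 2)} {ι : Type*} (t : Finset ι) (k : ι → ℕ)
    (f : ι → (M ⟶ N)) (x : M) :
    (∑ i ∈ t, ((-1 : ℤ) ^ k i) • f i).hom x = ∑ i ∈ t, (f i).hom x := by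
  rw [ModuleCat.hom_sum, LinearMap.sum_apply]
  refine Finset.sum_congr rfl fun i _ => ?_
  rcases neg_one_pow_eq_or ℤ (k i) with h | h <;> rw [h]
  · rw [one_smul]
  · rw [neg_one_smul, ModuleCat.hom_neg, LinearMap.neg_apply, neg_eq_iff_add_eq_zero,
      ZModModule.add_self]

open Simplicial in
theorem exists_singBd_eq (X : Type) [TopologicalSpace X] (n : ℕ)
    (h : Subsingleton (SingularHomology (ZMod 2) X (n + 1)))
    (c : C(stdSimplex ℝ (Fin (n + 2)), X) →₀ ZMod 2) (hc : singBd X n c = 0) :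
    ∃ e, singBd X (n + 1) e = c := by
  let Y := TopCat.toSSet.obj (TopCat.of X)
  let K := (alternatingFaceMapComplex (ModuleCat (ZMod 2))).obj
      (((SimplicialObject.whiskering _ _).obj (ModuleCat.free (ZMod 2))).obj Y)
  let u : ∀ m : ℕ, (C(stdSimplex ℝ (Fin (m + 1)), X) →₀ ZMod 2) ≃ₗ[ZMod 2] K.X m := fun m =>
    Finsupp.domLCongr ((TopCat.of X).toSSetObjEquiv (.op ⦋m⦌)).symm
  have hu : ∀ (m : ℕ) (c), (K.d (m + 1) m).hom (u (m + 1) c) = u m (singBd X m c) := by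
    intro m c
    induction c using Finsupp.induction_linear with
    | zero => simp only [map_zero]
    | add f g hf hg => simp only [map_add, hf, hg]
    | single s a =>
      have hd : K.d (m + 1) m = ∑ i : Fin (m + 2), ((-1 : ℤ) ^ (i : ℕ)) •
          (ModuleCat.free (ZMod 2)).map (Y.δ i) :=
        alternatingFaceMapComplex_obj_d _ _
      refine (congrArg (fun g => g.hom (u (m + 1) (Finsupp.single s a))) hd).trans ?_
      refine (signed_sum_apply _ _ _ _).trans ?_
      rw [singBd, LinearMap.sum_apply, map_sum]
      refine Finset.sum_congr rfl fun i _ => ?_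
      have h1 : u (m + 1) (Finsupp.single s a) =
          Finsupp.single (((TopCat.of X).toSSetObjEquiv (.op ⦋m + 1⦌)).symm s) a :=
        Finsupp.domLCongr_single _ _ _
      have h2 : Finsupp.lmapDomain (ZMod 2) (ZMod 2) (singFace i) (Finsupp.single s a) =
          Finsupp.single (singFace i s) a := Finsupp.mapDomain_single
      have h3 : u m (Finsupp.single (singFace i s) a) =
          Finsupp.single (((TopCat.of X).toSSetObjEquiv (.op ⦋m⦌)).symm (singFace i s)) a :=
        Finsupp.domLCongr_single _ _ _
      rw [h1, h2, h3]
      refine Eq.trans (Finsupp.mapDomain_single (f := Y.δ i)) ?_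
      congr 1
  have hex : K.ExactAt (n + 1) := by
    rw [HomologicalComplex.exactAt_iff_isZero_homology]
    exact ModuleCat.isZero_of_iff_subsingleton.mpr h
  rw [HomologicalComplex.exactAt_iff' K (n + 2) (n + 1) n (by simp) (by simp),
    ShortComplex.moduleCat_exact_iff] at hex
  obtain ⟨e, he⟩ := hex (u (n + 1) c) (by
    have := hu n c
    rw [hc, map_zero] at this
    exact this)
  refine ⟨(u (n + 2)).symm e, (u (n + 1)).injective ?_⟩
  rw [← hu]
  refine Eq.trans (congrArg _ ?_) he
  exact (u (n + 2)).apply_symm_apply e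

/-- Chains of ordered tuples, graded by the length of the tuple. -/
abbrev TupleChain (V : Type*) := List V →₀ ZMod 2

namespace TupleChain

variable {V W : Type*}

/-- The linear extension of a map on tuples. -/
noncomputable def lift {M : Type*} [AddCommGroup M] [Module (ZMod 2) M] (f : List V → M) :
    TupleChain V →ₗ[ZMod 2] M := Finsupp.linearCombination (ZMod 2) f

@[simp]
theorem lift_single {M : Type*} [AddCommGroup M] [Module (ZMod 2) M] (f : List V → M)
    (l : List V) : lift f (Finsupp.single l 1) = f l := by
  simp [lift]

theorem hom_ext {M : Type*} [AddCommGroup M] [Module (ZMod 2) M]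
    {f g : TupleChain V →ₗ[ZMod 2] M}
    (h : ∀ l, f (Finsupp.single l 1) = g (Finsupp.single l 1)) : f = g := by
  ext l; simpa using h l

/-- Chains all of whose tuples satisfy `P`. -/
noncomputable abbrev supp (P : List V → Prop) : Submodule (ZMod 2) (TupleChain V) :=
  Finsupp.supported (ZMod 2) (ZMod 2) {l | P l}

theorem single_mem_supp {P : List V → Prop} {l : List V} (h : P l) :
    Finsupp.single l 1 ∈ supp P := Finsupp.single_mem_supported _ _ h

theorem eqOn_supp {M : Type*} [AddCommGroup M] [Module (ZMod 2) M] {P : List V → Prop}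
    {f g : TupleChain V →ₗ[ZMod 2] M}
    (h : ∀ l, P l → f (Finsupp.single l 1) = g (Finsupp.single l 1))
    {c : TupleChain V} (hc : c ∈ supp P) : f c = g c := by
  rw [supp, Finsupp.supported_eq_span_single] at hc
  refine LinearMap.eqOn_span ?_ hc
  rintro _ ⟨l, hl, rfl⟩
  exact h l hl

theorem map_mem_of_supp {M : Type*} [AddCommGroup M] [Module (ZMod 2) M] {P : List V → Prop}
    {f : TupleChain V →ₗ[ZMod 2] M} {N : Submodule (ZMod 2) M}
    (h : ∀ l, P l → f (Finsupp.single l 1) ∈ N) {c : TupleChain V} (hc : c ∈ supp P) :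
    f c ∈ N := by
  rw [supp, Finsupp.supported_eq_span_single] at hc
  have : Submodule.span (ZMod 2) ((fun i => Finsupp.single i (1 : ZMod 2)) '' {l | P l}) ≤
      N.comap f := Submodule.span_le.2 (by rintro _ ⟨l, hl, rfl⟩; exact h l hl)
  exact this hc

theorem supp_mono {P Q : List V → Prop} (h : ∀ l, P l → Q l) : supp P ≤ supp Q :=
  Finsupp.supported_mono h

/-- Prepending a point to all tuples. -/
noncomputable def cone (x : V) : TupleChain V →ₗ[ZMod 2] TupleChain V :=
  lift fun l => Finsupp.single (x :: l) 1

/-- The image of a chain under a map of point sets. -/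
noncomputable def map (f : V → W) : TupleChain V →ₗ[ZMod 2] TupleChain W :=
  lift fun l => Finsupp.single (l.map f) 1

/-- The boundary of a tuple. -/
noncomputable def bdTuple : List V → TupleChain V
  | [] => 0
  | x :: l => Finsupp.single l 1 + cone x (bdTuple l)

/-- The augmented boundary operator. -/
noncomputable def bd : TupleChain V →ₗ[ZMod 2] TupleChain V := lift bdTuple

@[simp]
theorem cone_single (x : V) (l : List V) :
    cone x (Finsupp.single l 1) = Finsupp.single (x :: l) 1 := by simp [cone]

@[simp]
theorem map_single (f : V → W) (l : List V) :
    map f (Finsupp.single l 1) = Finsupp.single (l.map f) 1 := by simp [map]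

@[simp]
theorem bd_single_nil : bd (Finsupp.single ([] : List V) 1) = 0 := by simp [bd, bdTuple]

theorem bd_single_cons (x : V) (l : List V) : bd (Finsupp.single (x :: l) 1) =
    Finsupp.single l 1 + cone x (bd (Finsupp.single l 1)) := by simp [bd, bdTuple]

theorem bd_cone (x : V) (c : TupleChain V) : bd (cone x c) = c + cone x (bd c) := by
  have : bd ∘ₗ cone x = LinearMap.id + cone x ∘ₗ bd :=
    hom_ext fun l => by simp [bd_single_cons]
  exact LinearMap.congr_fun this c

theorem map_cone (f : V → W) (x : V) (c : TupleChain V) :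
    map f (cone x c) = cone (f x) (map f c) := by
  have : map f ∘ₗ cone x = cone (f x) ∘ₗ map f := hom_ext fun l => by simp
  exact LinearMap.congr_fun this c

theorem bd_map (f : V → W) (c : TupleChain V) : bd (map f c) = map f (bd c) := by
  have : bd ∘ₗ map f = map f ∘ₗ bd := hom_ext fun l => by
    induction l with
    | nil => simp
    | cons x l ih =>
      simp only [LinearMap.comp_apply, map_single, List.map_cons, bd_single_cons, map_add,
        map_cone] at ih ⊢
      rw [ih]
  exact LinearMap.congr_fun this c

theorem map_map {U : Type*} (f : V → W) (g : W → U) (c : TupleChain V) :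
    map g (map f c) = map (g ∘ f) c := by
  have : map g ∘ₗ map f = map (g ∘ f) := hom_ext fun l => by simp
  exact LinearMap.congr_fun this c

theorem bd_bd (c : TupleChain V) : bd (bd c) = 0 := by
  have : bd ∘ₗ bd = (0 : TupleChain V →ₗ[ZMod 2] _) := hom_ext fun l => by
    induction l with
    | nil => simp
    | cons x l ih =>
      simp only [LinearMap.comp_apply, LinearMap.zero_apply] at ih ⊢
      rw [bd_single_cons, map_add, bd_cone, ih, map_zero, add_zero, ZModModule.add_self]
  exact LinearMap.congr_fun this c

theorem bd_single_eq_sum (l : List V) :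
    bd (Finsupp.single l 1) = ∑ i : Fin l.length, Finsupp.single (l.eraseIdx i) 1 := by
  induction l with
  | nil => simp
  | cons x l ih =>
    rw [bd_single_cons, ih, map_sum]
    simp only [List.length_cons, Fin.sum_univ_succ, cone_single]
    simp

/-- Faces of tuples satisfying a hereditary property satisfy it as well. -/
theorem bd_mem_supp {P Q : List V → Prop} (h : ∀ l, P l → ∀ i < l.length, Q (l.eraseIdx i))
    {c : TupleChain V} (hc : c ∈ supp P) : bd c ∈ supp Q :=
  map_mem_of_supp (fun l hl => by
    rw [bd_single_eq_sum]
    exact Submodule.sum_mem _ fun i _ => single_mem_supp (h l hl i i.2)) hc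

/-- The correction term of the product of two points. -/
noncomputable def ezBase : List V → List W → TupleChain (V × W)
  | [], [] => Finsupp.single [] 1
  | _, _ => 0

/-- The Eilenberg-Zilber product of two tuples: the sum of all monotone lattice paths. -/
noncomputable def ezTuple : List V → List W → TupleChain (V × W)
  | [], _ => 0
  | _ :: _, [] => 0
  | x :: p, y :: q => cone (x, y) (ezBase p q + ezTuple p (y :: q) + ezTuple (x :: p) q)
termination_by p q => p.length + q.length

/-- The Eilenberg-Zilber product of chains. -/
noncomputable def ez : TupleChain V →ₗ[ZMod 2] TupleChain W →ₗ[ZMod 2] TupleChain (V × W) :=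
  lift fun p => lift fun q => ezTuple p q

theorem ez_single (p : List V) (q : List W) :
    ez (Finsupp.single p 1) (Finsupp.single q 1) = ezTuple p q := by simp [ez]

theorem ez_nil_left (c : TupleChain W) : ez (Finsupp.single ([] : List V) 1) c = 0 := by
  have : ez (Finsupp.single ([] : List V) 1) = (0 : TupleChain W →ₗ[ZMod 2] _) :=
    hom_ext fun q => by simp [ez_single, ezTuple]
  exact LinearMap.congr_fun this c

theorem ez_nil_right (c : TupleChain V) : ez c (Finsupp.single ([] : List W) 1) = 0 := by
  have : ez.flip (Finsupp.single ([] : List W) 1) = (0 : TupleChain V →ₗ[ZMod 2] _) :=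
    hom_ext fun q => by cases q <;> simp [ez_single, ezTuple]
  exact LinearMap.congr_fun this c

theorem ez_cons_cons (x : V) (p : List V) (y : W) (q : List W) :
    ez (Finsupp.single (x :: p) 1) (Finsupp.single (y :: q) 1) = cone (x, y) (ezBase p q +
      ez (Finsupp.single p 1) (Finsupp.single (y :: q) 1) +
      ez (Finsupp.single (x :: p) 1) (Finsupp.single q 1)) := by
  simp [ez_single, ezTuple]

/-- The base term, extended linearly. -/
noncomputable def ezb : TupleChain V →ₗ[ZMod 2] TupleChain W →ₗ[ZMod 2] TupleChain (V × W) :=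
  lift fun p => lift fun q => ezBase p q

theorem ez_cone_cone (x : V) (c : TupleChain V) (y : W) (e : TupleChain W) :
    ez (cone x c) (cone y e) =
      cone (x, y) (ezb c e + ez c (cone y e) + ez (cone x c) e) := by
  have : ez.compl₁₂ (cone x) (cone y) =
      (ezb + ez.compl₁₂ LinearMap.id (cone y) + ez.compl₁₂ (cone x) LinearMap.id).compr₂
        (cone (x, y)) := by
    refine hom_ext fun p => hom_ext fun q => ?_
    simp [ez_cons_cons, ezb]
  exact LinearMap.congr_fun (LinearMap.congr_fun this c) e

theorem ez_map_swap (p : List V) (q : List W) :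
    map Prod.swap (ez (Finsupp.single p 1) (Finsupp.single q 1)) =
      ez (Finsupp.single q 1) (Finsupp.single p 1) := by
  induction p generalizing q with
  | nil => simp [ez_nil_left, ez_nil_right]
  | cons x p ihp =>
    induction q with
    | nil => simp [ez_nil_left, ez_nil_right]
    | cons y q ihq =>
      rw [ez_cons_cons, ez_cons_cons, map_cone, (map Prod.swap).map_add, (map Prod.swap).map_add, ihp,
        ihq]
      have : map Prod.swap (ezBase p q) = ezBase q p := by
        cases p <;> cases q <;> simp [ezBase]
      rw [this]
      simp only [Prod.swap]
      congr 1
      abel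

theorem ezb_bd_left (p : List V) (q : List W) : ezb (bd (Finsupp.single p 1)) (Finsupp.single q 1) =
    if p.length = 1 ∧ q.length = 0 then Finsupp.single [] 1 else 0 := by
  have hc : ∀ (x : V) (c : TupleChain V), ezb (cone x c) (Finsupp.single q 1) = 0 := fun x c => by
    have : ezb.flip (Finsupp.single q 1) ∘ₗ cone x = 0 := hom_ext fun l => by simp [ezb, ezBase]
    exact LinearMap.congr_fun this c
  rcases p with _ | ⟨x, _ | ⟨y, p⟩⟩
  · simp
  · rw [bd_single_cons, map_add, LinearMap.add_apply, hc]
    cases q <;> simp [ezb, ezBase]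
  · rw [bd_single_cons, map_add, LinearMap.add_apply, hc]
    simp [ezb, ezBase]

theorem ezb_bd_right (p : List V) (q : List W) : ezb (Finsupp.single p 1) (bd (Finsupp.single q 1)) =
    if p.length = 0 ∧ q.length = 1 then Finsupp.single [] 1 else 0 := by
  have hc : ∀ (y : W) (c : TupleChain W), ezb (Finsupp.single p 1) (cone y c) = 0 := fun y c => by
    have : ezb (Finsupp.single p 1) ∘ₗ cone y = 0 := hom_ext fun l => by simp [ezb, ezBase]
    exact LinearMap.congr_fun this c
  rcases q with _ | ⟨x, _ | ⟨y, q⟩⟩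
  · simp
  · rw [bd_single_cons, map_add, hc]
    cases p <;> simp [ezb, ezBase]
  · rw [bd_single_cons, map_add, hc]
    simp [ezb, ezBase]

/-- The Leibniz rule for the Eilenberg-Zilber product, up to the augmentation in degree zero. -/
theorem bd_ez_single (p : List V) (q : List W) :
    bd (ez (Finsupp.single p 1) (Finsupp.single q 1)) =
      ez (bd (Finsupp.single p 1)) (Finsupp.single q 1) +
      ez (Finsupp.single p 1) (bd (Finsupp.single q 1)) +
      (if p.length = 1 ∧ q.length = 1 then Finsupp.single [] 1 else 0) := by
  induction p generalizing q with
  | nil => simp [ez_nil_left]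
  | cons x p ihp =>
    induction q with
    | nil => simp [ez_nil_right]
    | cons y q ihq =>
      have hb : bd (ezBase p q) = 0 := by cases p <;> cases q <;> simp [ezBase]
      have hb' : ezBase p q = if p.length = 0 ∧ q.length = 0 then Finsupp.single [] 1 else 0 := by
        cases p <;> cases q <;> simp [ezBase]
      have hp := ihp (y :: q)
      have hbp := ezb_bd_left p q
      have hbq := ezb_bd_right p q
      rw [ez_cons_cons, bd_cone, bd.map_add, bd.map_add, hb, hp, ihq, hb']
      simp only [← cone_single, bd_cone, map_add, LinearMap.add_apply,
        ez_cone_cone] at hbp hbq ⊢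
      rw [hbp, hbq]
      simp only [List.length_cons, Nat.add_eq_right]
      rw [map_zero, zero_add]
      have hX := ZModModule.add_self
        (cone (x, y) (ez (Finsupp.single p 1) (Finsupp.single q (1 : ZMod 2))))
      rw [← add_zero (_ + ite _ _ _), ← hX]
      abel

end TupleChain

section

variable {ι : Type*} [LinearOrder ι]

/-- The opposite of a signed colour. -/
def oppLabel (x : ι × Bool) : ι × Bool := (x.1, !x.2)

open Classical in
/-- The indicator of alternating label sets: all colours are distinct, and the signs alternate
along the colour order, starting with `true`. -/
noncomputable def fanWeight (M : Multiset (ι × Bool)) : ZMod 2 :=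
  if (M.map Prod.fst).Nodup ∧ ∀ x ∈ M, (x.2 = true ↔ Even (M.countP fun y => y.1 < x.1))
  then 1 else 0

theorem fanWeight_zero : fanWeight (0 : Multiset (ι × Bool)) = 1 := by
  simp [fanWeight]

theorem fanWeight_eq_zero {M : Multiset (ι × Bool)} (h : ¬(M.map Prod.fst).Nodup) :
    fanWeight M = 0 := if_neg fun h' => h h'.1

theorem fanWeight_cons (x : ι × Bool) (N : Multiset (ι × Bool)) (h : ∀ y ∈ N, y.1 < x.1) :
    fanWeight (x ::ₘ N) = if (x.2 = true ↔ Even N.card) then fanWeight N else 0 := by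
  have hx : x.1 ∉ N.map Prod.fst := fun hm => by
    obtain ⟨y, hy, hyx⟩ := Multiset.mem_map.1 hm
    exact (h y hy).ne hyx
  have h1 : (x ::ₘ N).countP (fun y => y.1 < x.1) = N.card := by
    rw [Multiset.countP_cons_of_neg (p := fun y : ι × Bool => y.1 < x.1) _ (lt_irrefl _),
      Multiset.countP_eq_card]
    exact h
  have h2 : ∀ y ∈ N, (x ::ₘ N).countP (fun z => z.1 < y.1) = N.countP (fun z => z.1 < y.1) :=
    fun y hy => Multiset.countP_cons_of_neg _ (h y hy).not_gt
  unfold fanWeight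
  rw [← ite_and]
  refine if_congr ?_ rfl rfl
  rw [Multiset.map_cons, Multiset.nodup_cons, Multiset.forall_mem_cons, h1]
  constructor
  · rintro ⟨⟨-, h3⟩, h4, h5⟩
    exact ⟨h4, h3, fun y hy => by rw [← h2 y hy]; exact h5 y hy⟩
  · rintro ⟨h4, h3, h5⟩
    exact ⟨⟨hx, h3⟩, h4, fun y hy => by rw [h2 y hy]; exact h5 y hy⟩

theorem sum_fanWeight_erase_of_nodup (n : ℕ) (M : Multiset (ι × Bool)) (hM : M.card = n)
    (h : (M.map Prod.fst).Nodup) :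
    (M.map fun x => fanWeight (M.erase x)).sum = fanWeight M + fanWeight (M.map oppLabel) := by
  induction n generalizing M with
  | zero =>
    obtain rfl := Multiset.card_eq_zero.1 hM
    simp [ZModModule.add_self]
  | succ n ih =>
    have hne : M.toFinset.Nonempty := by
      rw [Multiset.toFinset_nonempty, ← Multiset.card_pos]; omega
    obtain ⟨x, hx, hmax⟩ := M.toFinset.exists_max_image Prod.fst hne
    obtain ⟨N, rfl⟩ := Multiset.exists_cons_of_mem (Multiset.mem_toFinset.1 hx)
    rw [Multiset.map_cons, Multiset.nodup_cons] at h
    have hlt : ∀ y ∈ N, y.1 < x.1 := fun y hy =>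
      lt_of_le_of_ne (hmax y (by simp [hy])) fun he =>
        h.1 (he ▸ Multiset.mem_map_of_mem _ hy)
    have hcard : N.card = n := by simpa using hM
    have hih := ih N hcard h.2
    have hsum : (N.map fun y => fanWeight ((x ::ₘ N).erase y)).sum =
        (N.map fun y => if (x.2 = true ↔ Even N.card) then 0 else fanWeight (N.erase y)).sum := by
      refine congrArg _ (Multiset.map_congr rfl fun y hy => ?_)
      have hxy : x ≠ y := by rintro rfl; exact lt_irrefl _ (hlt _ hy)
      rw [Multiset.erase_cons_tail _ hxy,
        fanWeight_cons _ _ fun z hz => hlt z (Multiset.mem_of_mem_erase hz)]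
      have hN := Multiset.card_erase_add_one hy
      simp only [← hN, Nat.even_add_one]
      by_cases h3 : Even (N.erase y).card <;> cases hx2 : x.2 <;> simp [h3]
    have hopp : fanWeight ((x ::ₘ N).map oppLabel) =
        if (x.2 = true ↔ Even N.card) then 0 else fanWeight (N.map oppLabel) := by
      rw [Multiset.map_cons, fanWeight_cons, Multiset.card_map]
      · by_cases h3 : Even N.card <;> cases hx2 : x.2 <;> simp [h3, hx2, oppLabel]
      · intro y hy
        obtain ⟨z, hz, rfl⟩ := Multiset.mem_map.1 hy
        exact hlt z hz
    rw [Multiset.map_cons, Multiset.sum_cons, Multiset.erase_cons_head, hsum, hopp,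
      fanWeight_cons _ _ hlt]
    split_ifs with h3
    · simp
    · rw [hih, zero_add, ← add_assoc, ZModModule.add_self, zero_add]

theorem sum_fanWeight_erase (M : Multiset (ι × Bool))
    (h : ∀ x ∈ M, ∀ y ∈ M, x.1 = y.1 → x = y) :
    (M.map fun x => fanWeight (M.erase x)).sum = fanWeight M + fanWeight (M.map oppLabel) := by
  by_cases hn : (M.map Prod.fst).Nodup
  · exact sum_fanWeight_erase_of_nodup _ M rfl hn
  have hn' : ¬((M.map oppLabel).map Prod.fst).Nodup := by
    rw [Multiset.map_map]; exact hn
  rw [fanWeight_eq_zero hn, fanWeight_eq_zero hn', add_zero]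
  have hM : ¬M.Nodup := fun h' => hn (Multiset.Nodup.map_on h h')
  rw [Multiset.nodup_iff_le] at hM
  push Not at hM
  obtain ⟨x, hx⟩ := hM
  obtain ⟨N, hN⟩ := Multiset.le_iff_exists_add.1 hx
  obtain rfl : M = x ::ₘ x ::ₘ N := by rw [hN]; simp
  have hrep : ∀ N : Multiset (ι × Bool), fanWeight (x ::ₘ x ::ₘ N) = 0 := fun N =>
    fanWeight_eq_zero (by simp)
  have hzero : ((N.map fun y => fanWeight ((x ::ₘ x ::ₘ N).erase y))).sum = 0 := by
    refine Multiset.sum_eq_zero fun a ha => ?_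
    obtain ⟨y, hy, rfl⟩ := Multiset.mem_map.1 ha
    by_cases hxy : x = y
    · subst hxy
      obtain ⟨N', rfl⟩ := Multiset.exists_cons_of_mem hy
      rw [Multiset.erase_cons_head, hrep]
    · rw [Multiset.erase_cons_tail _ hxy, Multiset.erase_cons_tail _ hxy, hrep]
  rw [Multiset.map_cons, Multiset.map_cons, Multiset.sum_cons, Multiset.sum_cons, hzero, add_zero,
    ZModModule.add_self]

/-- The linear functional counting alternating tuples of labels. -/
noncomputable def fan : TupleChain (ι × Bool) →ₗ[ZMod 2] ZMod 2 :=
  TupleChain.lift fun l => fanWeight (l : Multiset (ι × Bool))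

theorem fan_bd (l : List (ι × Bool)) (h : ∀ x ∈ l, ∀ y ∈ l, x.1 = y.1 → x = y) :
    fan (TupleChain.bd (Finsupp.single l 1)) = fan (Finsupp.single l 1) +
      fan (TupleChain.map oppLabel (Finsupp.single l 1)) := by
  have h1 := sum_fanWeight_erase (l : Multiset (ι × Bool)) (by simpa using h)
  rw [TupleChain.bd_single_eq_sum, map_sum, TupleChain.map_single]
  simp only [fan, TupleChain.lift_single]
  rw [Multiset.map_coe oppLabel] at h1
  rw [← h1, Multiset.map_coe, Multiset.sum_coe, ← Fin.sum_univ_fun_getElem]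
  refine Finset.sum_congr rfl fun i _ => congrArg _ ?_
  have := List.getElem_cons_eraseIdx_perm i.2
  rw [← Multiset.coe_eq_coe, ← Multiset.cons_coe] at this
  conv_rhs => rw [← this]
  simp

theorem fan_eq_zero [Fintype ι] (l : List (ι × Bool)) (h : Fintype.card ι < l.length) :
    fan (Finsupp.single l 1) = 0 := by
  rw [fan, TupleChain.lift_single]
  refine fanWeight_eq_zero fun hn => ?_
  have := Multiset.toFinset_card_of_nodup hn
  have h2 := Finset.card_le_univ (Multiset.toFinset (Multiset.map Prod.fst (l : Multiset (ι × Bool))))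
  rw [this] at h2
  simp at h2
  omega

end

section

variable {V M : Type*} [DecidableEq V] [AddCommGroup M] [Module (ZMod 2) M]

theorem sum_erase_erase (s : Finset V) (f : Finset V → M) :
    ∑ v ∈ s, ∑ w ∈ s.erase v, f ((s.erase v).erase w) = 0 := by
  rw [Finset.sum_sigma']
  refine Finset.sum_involution (fun x _ => ⟨x.2, x.1⟩) ?_ ?_ ?_ ?_
  · rintro ⟨v, w⟩ -
    rw [Finset.erase_right_comm]
    exact ZModModule.add_self _
  · rintro ⟨v, w⟩ h - h2
    simp only [Finset.mem_sigma, Finset.mem_erase, Sigma.mk.injEq] at h h2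
    exact h.2.1 h2.1
  · rintro ⟨v, w⟩ h
    simp only [Finset.mem_sigma, Finset.mem_erase] at h ⊢
    exact ⟨h.2.2, h.2.1.symm, h.1⟩
  · rintro ⟨v, w⟩ -
    rfl

theorem sum_powerset_faces (s : Finset V) (g : Finset V → Finset V → M) :
    ∑ σ ∈ s.powerset, (∑ v ∈ σ, g (σ.erase v) (s \ σ) + ∑ v ∈ s \ σ, g σ ((s \ σ).erase v)) =
      0 := by
  have h1 : ∀ σ ∈ s.powerset,
      ∑ v ∈ σ, g (σ.erase v) (s \ σ) + ∑ v ∈ s \ σ, g σ ((s \ σ).erase v) =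
      ∑ v ∈ s, if v ∈ σ then g (σ.erase v) (s \ σ) else g σ ((s \ σ).erase v) := by
    intro σ hσ
    rw [← Finset.sum_sdiff (Finset.mem_powerset.1 hσ), add_comm]
    congr 1
    · exact Finset.sum_congr rfl fun v hv => (if_neg (Finset.mem_sdiff.1 hv).2).symm
    · exact Finset.sum_congr rfl fun v hv => (if_pos hv).symm
  rw [Finset.sum_congr rfl h1, Finset.sum_comm]
  refine Finset.sum_eq_zero fun v hv => ?_
  obtain ⟨u, hu, rfl⟩ : ∃ u, v ∉ u ∧ insert v u = s :=
    ⟨s.erase v, Finset.notMem_erase _ _, Finset.insert_erase hv⟩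
  rw [Finset.sum_powerset_insert hu, ← Finset.sum_add_distrib]
  refine Finset.sum_eq_zero fun σ hσ => ?_
  have hvσ : v ∉ σ := fun h => hu (Finset.mem_powerset.1 hσ h)
  rw [if_neg hvσ, if_pos (Finset.mem_insert_self _ _), Finset.erase_insert hvσ]
  have : (insert v u \ σ).erase v = insert v u \ insert v σ := by
    ext x; simp only [Finset.mem_erase, Finset.mem_sdiff, Finset.mem_insert]; tauto
  rw [this, ZModModule.add_self]

end

section

variable {V : Type*} [DecidableEq V]

/-- The identity satisfied by the van Kampen type pairing of disjoint simplices. -/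
def PairingIdentity (β : Finset V → Finset V → ZMod 2) (σ τ : Finset V) : Prop :=
  β σ τ + β τ σ = ∑ v ∈ σ, β (σ.erase v) τ + ∑ v ∈ τ, β σ (τ.erase v) +
    if σ.card = 1 ∧ τ.card = 1 then 1 else 0

/-- The sum of a pairing over all ordered partitions of a set. -/
def partitionSum (β : Finset V → Finset V → ZMod 2) (s : Finset V) : ZMod 2 :=
  ∑ σ ∈ s.powerset, β σ (s \ σ)

theorem partitionSum_insert {β : Finset V → Finset V → ZMod 2} {s : Finset V} {a : V}
    (ha : a ∉ s) (h : ∀ σ τ, Disjoint σ τ → σ.card + τ.card = s.card + 1 → PairingIdentity β σ τ) :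
    partitionSum β (insert a s) = partitionSum β s + if s.card = 1 then 1 else 0 := by
  have hsub : ∀ σ ∈ s.powerset, a ∉ σ := fun σ hσ h => ha (Finset.mem_powerset.1 hσ h)
  have hcompl : ∑ σ ∈ s.powerset, β σ (insert a s \ σ) =
      ∑ σ ∈ s.powerset, β (s \ σ) (insert a σ) := by
    refine Finset.sum_nbij' (fun σ => s \ σ) (fun σ => s \ σ) (by simp) (by simp) ?_ ?_ ?_
    · intro σ hσ
      exact Finset.sdiff_sdiff_eq_self (Finset.mem_powerset.1 hσ)
    · intro σ hσ
      exact Finset.sdiff_sdiff_eq_self (Finset.mem_powerset.1 hσ)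
    · intro σ hσ
      rw [Finset.sdiff_sdiff_eq_self (Finset.mem_powerset.1 hσ),
        Finset.insert_sdiff_of_notMem _ (hsub σ hσ)]
  have key : ∀ σ ∈ s.powerset, β (s \ σ) (insert a σ) + β (insert a σ) (insert a s \ insert a σ) =
      β σ (s \ σ) + (∑ v ∈ σ, β (insert a (σ.erase v)) (s \ σ) +
        ∑ v ∈ s \ σ, β (insert a σ) ((s \ σ).erase v)) +
        if σ = ∅ then (if s.card = 1 then 1 else 0) else 0 := by
    intro σ hσ
    have haσ := hsub σ hσ
    rw [Finset.mem_powerset] at hσ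
    have h1 : insert a s \ insert a σ = s \ σ := by
      ext x; simp only [Finset.mem_sdiff, Finset.mem_insert]
      by_cases hx : x = a
      · subst hx; simp [ha]
      · simp [hx]
    have hdj : Disjoint (insert a σ) (s \ σ) := by
      rw [Finset.disjoint_insert_left]
      exact ⟨fun h => ha (Finset.mem_sdiff.1 h).1, Finset.disjoint_sdiff⟩
    have hc : σ.card + (s \ σ).card = s.card := by
      rw [add_comm]; exact Finset.card_sdiff_add_card_eq_card hσ
    have := h (insert a σ) (s \ σ) hdj (by rw [Finset.card_insert_of_notMem haσ]; omega)
    unfold PairingIdentity at this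
    rw [Finset.sum_insert haσ, Finset.erase_insert haσ, Finset.card_insert_of_notMem haσ] at this
    rw [h1, add_comm, this]
    have h3 : ∑ v ∈ σ, β ((insert a σ).erase v) (s \ σ) =
        ∑ v ∈ σ, β (insert a (σ.erase v)) (s \ σ) := by
      refine Finset.sum_congr rfl fun v hv => ?_
      rw [Finset.erase_insert_of_ne]
      rintro rfl; exact haσ hv
    have h4 : (if σ.card + 1 = 1 ∧ (s \ σ).card = 1 then (1 : ZMod 2) else 0) =
        if σ = ∅ then (if s.card = 1 then 1 else 0) else 0 := by
      by_cases h5 : σ = ∅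
      · subst h5; simp
      · simp [h5]
    rw [h3, h4]
    ring
  rw [partitionSum, Finset.sum_powerset_insert ha, hcompl, ← Finset.sum_add_distrib,
    Finset.sum_congr rfl key, Finset.sum_add_distrib, Finset.sum_add_distrib,
    sum_powerset_faces s fun σ τ => β (insert a σ) τ, add_zero, Finset.sum_ite_eq',
    if_pos (Finset.empty_mem_powerset s), partitionSum]

theorem partitionSum_eq_one {β : Finset V → Finset V → ZMod 2} {s : Finset V} (hs : 2 ≤ s.card)
    (h0 : β ∅ ∅ = 0)
    (h : ∀ σ τ, Disjoint σ τ → σ.card + τ.card ≤ s.card → PairingIdentity β σ τ) :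
    partitionSum β s = 1 := by
  have main : ∀ t ⊆ s, partitionSum β t = if 2 ≤ t.card then 1 else 0 := by
    intro t
    induction t using Finset.induction with
    | empty => intro _; simp [partitionSum, h0]
    | insert a t ha ih =>
      intro hts
      have hle := Finset.card_le_card hts
      rw [Finset.card_insert_of_notMem ha] at hle ⊢
      rw [partitionSum_insert ha fun σ τ hd hc => h σ τ hd (by omega),
        ih ((Finset.subset_insert _ _).trans hts)]
      rcases lt_trichotomy t.card 1 with h1 | h1 | h1
      · rw [if_neg (by omega), if_neg (by omega), if_neg (by omega), add_zero]
      · rw [if_neg (by omega), if_pos h1, if_pos (by omega), zero_add]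
      · rw [if_pos (by omega), if_neg (by omega), if_pos (by omega), add_zero]
  rw [main s subset_rfl, if_pos hs]

/-- The extension of a pairing of simplices of dimension at most `k` by one dimension. -/
def extendPairing (k : ℕ) (α : Finset V → Finset V → ZMod 2) (σ τ : Finset V) : ZMod 2 :=
  if σ.card ≤ k + 1 ∧ τ.card ≤ k + 1 then α σ τ
  else if σ.card = k + 2 then (if Even (σ.card + τ.card) then ∑ v ∈ σ, α (σ.erase v) τ else 0)
  else if τ.card = k + 2 then (if Even (σ.card + τ.card) then 0 else ∑ v ∈ τ, α σ (τ.erase v))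
  else 0

theorem pairingIdentity_extendPairing {k n : ℕ} (hk : 1 ≤ k) (hn : n ≤ 2 * k + 3)
    {α : Finset V → Finset V → ZMod 2}
    (h : ∀ σ τ, Disjoint σ τ → σ.card ≤ k + 1 → τ.card ≤ k + 1 → PairingIdentity α σ τ)
    (σ τ : Finset V) (hd : Disjoint σ τ) (hc : σ.card + τ.card ≤ n) :
    PairingIdentity (extendPairing k α) σ τ := by
  have hce : ∀ {σ : Finset V} {v : V}, v ∈ σ → (σ.erase v).card + 1 = σ.card := fun hv =>
    Finset.card_erase_add_one hv
  unfold PairingIdentity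
  by_cases h1 : σ.card ≤ k + 1 ∧ τ.card ≤ k + 1
  · have e0 : extendPairing k α σ τ = α σ τ := if_pos h1
    have e1 : extendPairing k α τ σ = α τ σ := if_pos h1.symm
    have e2 : ∀ v ∈ σ, extendPairing k α (σ.erase v) τ = α (σ.erase v) τ := fun v hv =>
      if_pos (by have := hce hv; omega)
    have e3 : ∀ v ∈ τ, extendPairing k α σ (τ.erase v) = α σ (τ.erase v) := fun v hv =>
      if_pos (by have := hce hv; omega)
    rw [e0, e1, Finset.sum_congr rfl e2, Finset.sum_congr rfl e3]
    exact h σ τ hd h1.1 h1.2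
  have hcorr : ¬(σ.card = 1 ∧ τ.card = 1) := by omega
  rw [if_neg hcorr, add_zero]
  by_cases h2 : σ.card = k + 2
  · have hτ : τ.card ≤ k + 1 := by omega
    have e2 : ∀ v ∈ σ, extendPairing k α (σ.erase v) τ = α (σ.erase v) τ := fun v hv =>
      if_pos (by have := hce hv; omega)
    by_cases hev : Even (σ.card + τ.card)
    · have e0 : extendPairing k α σ τ = ∑ v ∈ σ, α (σ.erase v) τ := by
        rw [extendPairing, if_neg h1, if_pos h2, if_pos hev]
      have e1 : extendPairing k α τ σ = 0 := by
        rw [extendPairing, if_neg (by omega), if_neg (by omega), if_pos h2, if_pos]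
        rwa [add_comm]
      have e3 : ∀ v ∈ τ, extendPairing k α σ (τ.erase v) = 0 := fun v hv => by
        have := hce hv
        rw [extendPairing, if_neg (by omega), if_pos h2, if_neg]
        rw [← this, ← add_assoc, Nat.even_add_one] at hev
        tauto
      rw [e0, e1, Finset.sum_congr rfl e2, Finset.sum_congr rfl e3, Finset.sum_const_zero]
    · have e0 : extendPairing k α σ τ = 0 := by
        rw [extendPairing, if_neg h1, if_pos h2, if_neg hev]
      have e1 : extendPairing k α τ σ = ∑ v ∈ σ, α τ (σ.erase v) := by
        rw [extendPairing, if_neg (by omega), if_neg (by omega), if_pos h2, if_neg]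
        rwa [add_comm]
      have e3 : ∀ w ∈ τ, extendPairing k α σ (τ.erase w) = ∑ v ∈ σ, α (σ.erase v) (τ.erase w) :=
        fun w hw => by
        have := hce hw
        rw [extendPairing, if_neg (by omega), if_pos h2, if_pos]
        rw [← this, ← add_assoc, Nat.even_add_one] at hev
        tauto
      have hid : ∀ v ∈ σ, α τ (σ.erase v) = α (σ.erase v) τ +
          ∑ u ∈ σ.erase v, α ((σ.erase v).erase u) τ + ∑ w ∈ τ, α (σ.erase v) (τ.erase w) := by
        intro v hv
        have hv' := hce hv
        have := h (σ.erase v) τ (hd.mono_left (Finset.erase_subset _ _)) (by omega) hτ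
        unfold PairingIdentity at this
        rw [if_neg (by omega), add_zero] at this
        rw [add_assoc, ← this, ← add_assoc, CharTwo.add_self_eq_zero, zero_add]
      rw [e0, e1, Finset.sum_congr rfl e2, Finset.sum_congr rfl e3, Finset.sum_congr rfl hid,
        Finset.sum_add_distrib, Finset.sum_add_distrib, sum_erase_erase σ fun s => α s τ,
        Finset.sum_comm (s := τ)]
      ring
  by_cases h3 : τ.card = k + 2
  · have hσ : σ.card ≤ k + 1 := by omega
    have e3 : ∀ v ∈ τ, extendPairing k α σ (τ.erase v) = α σ (τ.erase v) := fun v hv =>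
      if_pos (by have := hce hv; omega)
    by_cases hev : Even (σ.card + τ.card)
    · have e0 : extendPairing k α σ τ = 0 := by
        rw [extendPairing, if_neg h1, if_neg h2, if_pos h3, if_pos hev]
      have e1 : extendPairing k α τ σ = ∑ w ∈ τ, α (τ.erase w) σ := by
        rw [extendPairing, if_neg (by omega), if_pos h3, if_pos]
        rwa [add_comm]
      have e2 : ∀ v ∈ σ, extendPairing k α (σ.erase v) τ = ∑ w ∈ τ, α (σ.erase v) (τ.erase w) :=
        fun v hv => by
        have := hce hv
        rw [extendPairing, if_neg (by omega), if_neg (by omega), if_pos h3, if_neg]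
        rw [← this, add_right_comm, Nat.even_add_one] at hev
        tauto
      have hid : ∀ w ∈ τ, α (τ.erase w) σ = α σ (τ.erase w) +
          ∑ v ∈ σ, α (σ.erase v) (τ.erase w) + ∑ u ∈ τ.erase w, α σ ((τ.erase w).erase u) := by
        intro w hw
        have hw' := hce hw
        have := h σ (τ.erase w) (hd.mono_right (Finset.erase_subset _ _)) hσ (by omega)
        unfold PairingIdentity at this
        rw [if_neg (by omega), add_zero] at this
        rw [add_assoc, ← this, ← add_assoc, CharTwo.add_self_eq_zero, zero_add]
      rw [e0, e1, Finset.sum_congr rfl e2, Finset.sum_congr rfl e3, Finset.sum_congr rfl hid,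
        Finset.sum_add_distrib, Finset.sum_add_distrib, sum_erase_erase τ fun s => α σ s,
        Finset.sum_comm (s := τ)]
      ring
    · have e0 : extendPairing k α σ τ = ∑ w ∈ τ, α σ (τ.erase w) := by
        rw [extendPairing, if_neg h1, if_neg h2, if_pos h3, if_neg hev]
      have e1 : extendPairing k α τ σ = 0 := by
        rw [extendPairing, if_neg (by omega), if_pos h3, if_neg]
        rwa [add_comm]
      have e2 : ∀ v ∈ σ, extendPairing k α (σ.erase v) τ = 0 := fun v hv => by
        have := hce hv
        rw [extendPairing, if_neg (by omega), if_neg (by omega), if_pos h3, if_pos]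
        rw [← this, add_right_comm, Nat.even_add_one] at hev
        tauto
      rw [e0, e1, Finset.sum_congr rfl e2, Finset.sum_congr rfl e3, Finset.sum_const_zero]
      ring
  have big : ∀ σ τ : Finset V, k + 3 ≤ σ.card → Disjoint σ τ → σ.card + τ.card ≤ 2 * k + 3 →
      extendPairing k α σ τ = 0 ∧ extendPairing k α τ σ = 0 ∧
      ∑ v ∈ σ, extendPairing k α (σ.erase v) τ = 0 ∧
      ∑ v ∈ σ, extendPairing k α τ (σ.erase v) = 0 ∧
      ∑ v ∈ τ, extendPairing k α σ (τ.erase v) = 0 ∧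
      ∑ v ∈ τ, extendPairing k α (τ.erase v) σ = 0 := by
    intro σ τ h4 hd hc
    have hz : ∀ τ : Finset V, τ.card ≤ k →
        extendPairing k α σ τ = 0 ∧ extendPairing k α τ σ = 0 := fun τ hτ => by
      constructor
      · rw [extendPairing, if_neg (by omega), if_neg (by omega), if_neg (by omega)]
      · rw [extendPairing, if_neg (by omega), if_neg (by omega), if_neg (by omega)]
    have hz' : ∀ v ∈ τ, (τ.erase v).card ≤ k := fun v hv => by have := hce hv; omega
    refine ⟨(hz τ (by omega)).1, (hz τ (by omega)).2, ?_, ?_,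
      Finset.sum_eq_zero fun v hv => (hz _ (hz' v hv)).1,
      Finset.sum_eq_zero fun v hv => (hz _ (hz' v hv)).2⟩
    · by_cases h5 : σ.card = k + 3 ∧ Even (k + 2 + τ.card)
      · rw [← sum_erase_erase σ fun s => α s τ]
        refine Finset.sum_congr rfl fun v hv => ?_
        have h6 : (σ.erase v).card = k + 2 := by have := hce hv; omega
        rw [extendPairing, if_neg (by omega), if_pos h6, h6, if_pos h5.2]
      · refine Finset.sum_eq_zero fun v hv => ?_
        have := hce hv
        rw [extendPairing, if_neg (by omega)]
        split_ifs with h6 h7 h8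
        · exact absurd ⟨by omega, h6 ▸ h7⟩ h5
        · rfl
        · omega
        · omega
        · rfl
    · by_cases h5 : σ.card = k + 3 ∧ ¬Even (τ.card + (k + 2))
      · rw [← sum_erase_erase σ fun s => α τ s]
        refine Finset.sum_congr rfl fun v hv => ?_
        have h6 : (σ.erase v).card = k + 2 := by have := hce hv; omega
        rw [extendPairing, if_neg (by omega), if_neg (by omega), if_pos h6, h6, if_neg h5.2]
      · refine Finset.sum_eq_zero fun v hv => ?_
        have := hce hv
        rw [extendPairing, if_neg (by omega), if_neg (by omega)]
        split_ifs with h6 h7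
        · rfl
        · exact absurd ⟨by omega, h6 ▸ h7⟩ h5
        · rfl
  by_cases h4 : k + 3 ≤ σ.card
  · obtain ⟨e1, e2, e3, -, e5, -⟩ := big σ τ h4 hd (by omega)
    rw [e1, e2, e3, e5]
  · obtain ⟨e1, e2, -, e4, -, e6⟩ := big τ σ (by omega) hd.symm (by omega)
    rw [e1, e2, e4, e6]

/-- There is no pairing of simplices satisfying the identity of general position that vanishes
above the middle dimension. -/
theorem not_pairing [Fintype V] {k : ℕ} (hk : 1 ≤ k) (h2 : 2 ≤ Fintype.card V)
    (hn : Fintype.card V ≤ 2 * k + 3) {α : Finset V → Finset V → ZMod 2}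
    (h0 : α ∅ ∅ = 0)
    (h : ∀ σ τ, Disjoint σ τ → σ.card ≤ k + 1 → τ.card ≤ k + 1 → PairingIdentity α σ τ)
    (hv : ∀ σ τ, Disjoint σ τ → σ.card ≤ k + 1 → τ.card ≤ k + 1 →
      Fintype.card V ≤ σ.card + τ.card + 1 → α σ τ = 0) : False := by
  have h1 := partitionSum_eq_one (β := extendPairing k α) (s := Finset.univ)
    (by rwa [Finset.card_univ]) (by rw [extendPairing, if_pos (by simp), h0])
    fun σ τ hd hc => pairingIdentity_extendPairing hk hn h σ τ hd (by simpa using hc)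
  refine zero_ne_one (α := ZMod 2) (Eq.trans ?_ h1)
  refine (Finset.sum_eq_zero fun σ hσ => ?_).symm
  have hd : Disjoint σ (Finset.univ \ σ) := Finset.disjoint_sdiff
  have hc : σ.card + (Finset.univ \ σ).card = Fintype.card V := by
    rw [← Finset.card_union_of_disjoint hd, Finset.union_sdiff_of_subset (Finset.subset_univ _),
      Finset.card_univ]
  generalize Finset.univ \ σ = τ at hd hc
  rw [extendPairing]
  split_ifs with h3 h4 h5 h6
  · exact hv σ τ hd h3.1 h3.2 (by omega)
  · refine Finset.sum_eq_zero fun v hv' => ?_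
    have := Finset.card_erase_add_one hv'
    exact hv _ τ (hd.mono_left (Finset.erase_subset _ _)) (by omega) (by omega) (by omega)
  · rfl
  · rfl
  · refine Finset.sum_eq_zero fun v hv' => ?_
    have := Finset.card_erase_add_one hv'
    exact hv σ _ (hd.mono_right (Finset.erase_subset _ _)) (by omega) (by omega) (by omega)
  · rfl

end

namespace TupleChain

variable {V W : Type*}

theorem eqOn_supp₂ {M : Type*} [AddCommGroup M] [Module (ZMod 2) M] {P : List V → Prop}
    {Q : List W → Prop} {f g : TupleChain V →ₗ[ZMod 2] TupleChain W →ₗ[ZMod 2] M}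
    (h : ∀ p q, P p → Q q → f (Finsupp.single p 1) (Finsupp.single q 1) =
      g (Finsupp.single p 1) (Finsupp.single q 1))
    {c : TupleChain V} (hc : c ∈ supp P) {e : TupleChain W} (he : e ∈ supp Q) : f c e = g c e :=
  eqOn_supp (f := f.flip e) (g := g.flip e) (fun p hp => eqOn_supp (fun q => h p q hp) he) hc

theorem ezTuple_mem_supp (p : List V) (q : List W) :
    ezTuple p q ∈ supp fun l => l.length + 1 = p.length + q.length ∧ ∀ z ∈ l, z.1 ∈ p ∧ z.2 ∈ q := by
  induction p generalizing q with
  | nil => rw [ezTuple]; exact Submodule.zero_mem _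
  | cons x p ihp =>
    induction q with
    | nil => rw [ezTuple]; exact Submodule.zero_mem _
    | cons y q ihq =>
      rw [ezTuple]
      have hcone : ∀ {c : TupleChain (V × W)}, (c ∈ supp fun l =>
          l.length + 1 = p.length + q.length + 1 ∧ ∀ z ∈ l, z.1 ∈ x :: p ∧ z.2 ∈ y :: q) →
          cone (x, y) c ∈ supp fun l => l.length + 1 = (x :: p).length + (y :: q).length ∧
            ∀ z ∈ l, z.1 ∈ x :: p ∧ z.2 ∈ y :: q := by
        refine fun hc => map_mem_of_supp (fun l hl => ?_) hc
        rw [cone_single]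
        refine single_mem_supp ⟨?_, ?_⟩
        · simp only [List.length_cons]; omega
        · rintro z hz
          rcases List.mem_cons.1 hz with rfl | hz
          · simp
          · exact hl.2 z hz
      refine hcone (Submodule.add_mem _ (Submodule.add_mem _ ?_ ?_) ?_)
      · cases p <;> cases q
        · exact single_mem_supp (by simp)
        all_goals exact Submodule.zero_mem _
      · refine supp_mono (fun l hl => ⟨?_, fun z hz => ?_⟩) (ihp (y :: q))
        · have := hl.1; simp only [List.length_cons] at this; omega
        · exact ⟨List.mem_cons_of_mem _ (hl.2 z hz).1, (hl.2 z hz).2⟩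
      · refine supp_mono (fun l hl => ⟨?_, fun z hz => ?_⟩) ihq
        · have := hl.1; simp only [List.length_cons] at this; omega
        · exact ⟨(hl.2 z hz).1, List.mem_cons_of_mem _ (hl.2 z hz).2⟩

theorem bd_single_apply_nil (l : List V) :
    bd (Finsupp.single l 1) [] = if l.length = 1 then 1 else 0 := by
  have hc : ∀ (x : V) (c : TupleChain V), cone x c [] = 0 := fun x c => by
    have : Finsupp.lapply [] ∘ₗ cone x = (0 : TupleChain V →ₗ[ZMod 2] ZMod 2) :=
      hom_ext fun l => by simp
    exact LinearMap.congr_fun this c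
  rcases l with _ | ⟨x, _ | ⟨y, l⟩⟩
  · simp
  · rw [bd_single_cons, Finsupp.add_apply, hc]; simp
  · rw [bd_single_cons, Finsupp.add_apply, hc]; simp

end TupleChain

section

variable {d : ℕ} [NeZero d]

/-- The index of a maximal coordinate. -/
noncomputable def argmaxCoord (w : Fin d → ℝ) : Fin d := (Finite.exists_max w).choose

theorem le_argmaxCoord (w : Fin d → ℝ) (i : Fin d) : w i ≤ w (argmaxCoord w) :=
  (Finite.exists_max w).choose_spec i

open Classical in
/-- The coordinate in which two points differ most, together with the sign of the difference. -/
noncomputable def pairLabel (z : (Fin d → ℝ) × (Fin d → ℝ)) : Fin d × Bool :=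
  let i := argmaxCoord fun i => |z.1 i - z.2 i|
  (i, decide (z.2 i < z.1 i))

theorem dist_eq_abs_pairLabel (z : (Fin d → ℝ) × (Fin d → ℝ)) :
    dist z.1 z.2 = |z.1 (pairLabel z).1 - z.2 (pairLabel z).1| := by
  refine le_antisymm ((dist_pi_le_iff (abs_nonneg _)).2 fun i => ?_) ?_
  · rw [Real.dist_eq]
    exact le_argmaxCoord (fun i => |z.1 i - z.2 i|) i
  · rw [← Real.dist_eq]
    exact dist_le_pi_dist _ _ _

theorem pairLabel_swap (z : (Fin d → ℝ) × (Fin d → ℝ)) (h : 0 < dist z.1 z.2) :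
    pairLabel z.swap = oppLabel (pairLabel z) := by
  rw [dist_eq_abs_pairLabel, abs_pos, sub_ne_zero] at h
  have h1 : (pairLabel z.swap).1 = (pairLabel z).1 := by
    simp only [pairLabel, Prod.fst_swap, Prod.snd_swap, abs_sub_comm]
  refine Prod.ext h1 ?_
  change decide (z.1 (pairLabel z.swap).1 < z.2 (pairLabel z.swap).1) =
    !decide (z.2 (pairLabel z).1 < z.1 (pairLabel z).1)
  rw [h1]
  rcases h.lt_or_gt with h2 | h2 <;> simp [h2, h2.not_gt]

theorem pairLabel_eq {ε : ℝ} {z w : (Fin d → ℝ) × (Fin d → ℝ)} (hz : 2 * ε ≤ dist z.1 z.2)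
    (hw : 2 * ε ≤ dist w.1 w.2) (h1 : dist z.1 w.1 < ε) (h2 : dist z.2 w.2 < ε)
    (h : (pairLabel z).1 = (pairLabel w).1) : pairLabel z = pairLabel w := by
  refine Prod.ext h ?_
  rw [dist_eq_abs_pairLabel] at hz hw
  change decide (z.2 (pairLabel z).1 < z.1 (pairLabel z).1) =
    decide (w.2 (pairLabel w).1 < w.1 (pairLabel w).1)
  rw [← h] at hw ⊢
  generalize (pairLabel z).1 = i at hz hw
  have h1' := (dist_le_pi_dist z.1 w.1 i).trans_lt h1
  have h2' := (dist_le_pi_dist z.2 w.2 i).trans_lt h2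
  rw [Real.dist_eq, abs_lt] at h1' h2'
  rw [decide_eq_decide]
  rw [le_abs] at hz hw
  constructor <;> intro h3 <;> by_contra h4 <;> rcases hz with hz | hz <;> rcases hw with hw | hw <;>
    linarith [h1'.1, h1'.2, h2'.1, h2'.2]

/-- The pairing of chains of tuples counting alternating labels on the product. -/
noncomputable def fanPairing : TupleChain (Fin d → ℝ) →ₗ[ZMod 2] TupleChain (Fin d → ℝ) →ₗ[ZMod 2]
    ZMod 2 :=
  TupleChain.ez.compr₂ (fan ∘ₗ TupleChain.map pairLabel)

theorem fanPairing_single {ε : ℝ} (hε : 0 < ε) (p q : List (Fin d → ℝ))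
    (hp : ∀ x ∈ p, ∀ y ∈ p, dist x y < ε) (hq : ∀ x ∈ q, ∀ y ∈ q, dist x y < ε)
    (hpq : ∀ x ∈ p, ∀ y ∈ q, 2 * ε ≤ dist x y) :
    fanPairing (Finsupp.single p 1) (Finsupp.single q 1) +
      fanPairing (Finsupp.single q 1) (Finsupp.single p 1) =
    fanPairing (TupleChain.bd (Finsupp.single p 1)) (Finsupp.single q 1) +
      fanPairing (Finsupp.single p 1) (TupleChain.bd (Finsupp.single q 1)) +
      (TupleChain.bd (Finsupp.single p 1) []) * (TupleChain.bd (Finsupp.single q 1) []) := by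
  have h1 := congrArg (fan ∘ₗ TupleChain.map pairLabel) (TupleChain.bd_ez_single p q)
  have h2 : (if p.length = 1 ∧ q.length = 1 then 1 else 0 : ZMod 2) =
      (TupleChain.bd (Finsupp.single p 1) []) * (TupleChain.bd (Finsupp.single q 1) []) := by
    rw [TupleChain.bd_single_apply_nil, TupleChain.bd_single_apply_nil, ite_and]
    split_ifs <;> simp
  have h3 : (fan ∘ₗ TupleChain.map pairLabel)
      ((if p.length = 1 ∧ q.length = 1 then Finsupp.single [] 1 else 0) :
        TupleChain ((Fin d → ℝ) × (Fin d → ℝ))) =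
      if p.length = 1 ∧ q.length = 1 then 1 else 0 := by
    split_ifs
    · simp [fan, fanWeight_zero]
    · simp
  rw [map_add, map_add, h3, h2] at h1
  refine Eq.trans ?_ h1
  change fan (TupleChain.map pairLabel (TupleChain.ez _ _)) +
    fan (TupleChain.map pairLabel (TupleChain.ez _ _)) = _
  rw [← TupleChain.ez_map_swap p q, TupleChain.ez_single, LinearMap.comp_apply, ← TupleChain.bd_map]
  have := TupleChain.eqOn_supp (f := fan ∘ₗ TupleChain.map pairLabel +
    fan ∘ₗ TupleChain.map pairLabel ∘ₗ TupleChain.map Prod.swap)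
    (g := fan ∘ₗ TupleChain.bd ∘ₗ TupleChain.map pairLabel) ?_ (TupleChain.ezTuple_mem_supp p q)
  · exact this
  · rintro l ⟨-, hl⟩
    simp only [LinearMap.add_apply, LinearMap.comp_apply, TupleChain.map_single]
    have h4 : List.map pairLabel (l.map Prod.swap) = (l.map pairLabel).map oppLabel := by
      rw [List.map_map, List.map_map]
      refine List.map_congr_left fun z hz => pairLabel_swap z ?_
      have := hpq _ (hl z hz).1 _ (hl z hz).2
      linarith
    rw [h4, fan_bd, TupleChain.map_single]
    intro x hx y hy
    obtain ⟨z, hz, rfl⟩ := List.mem_map.1 hx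
    obtain ⟨w, hw, rfl⟩ := List.mem_map.1 hy
    exact pairLabel_eq (hpq _ (hl z hz).1 _ (hl z hz).2) (hpq _ (hl w hw).1 _ (hl w hw).2)
      (hp _ (hl z hz).1 _ (hl w hw).1) (hq _ (hl z hz).2 _ (hl w hw).2)

theorem fanPairing_add_swap {ε : ℝ} (hε : 0 < ε) {P Q : List (Fin d → ℝ) → Prop}
    (hP : ∀ p, P p → ∀ x ∈ p, ∀ y ∈ p, dist x y < ε)
    (hQ : ∀ p, Q p → ∀ x ∈ p, ∀ y ∈ p, dist x y < ε)
    (hPQ : ∀ p q, P p → Q q → ∀ x ∈ p, ∀ y ∈ q, 2 * ε ≤ dist x y)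
    {c e : TupleChain (Fin d → ℝ)} (hc : c ∈ TupleChain.supp P) (he : e ∈ TupleChain.supp Q) :
    fanPairing c e + fanPairing e c = fanPairing (TupleChain.bd c) e +
      fanPairing c (TupleChain.bd e) + (TupleChain.bd c []) * (TupleChain.bd e []) := by
  let ev : TupleChain (Fin d → ℝ) →ₗ[ZMod 2] ZMod 2 := Finsupp.lapply [] ∘ₗ TupleChain.bd
  exact TupleChain.eqOn_supp₂ (f := fanPairing + fanPairing.flip)
    (g := fanPairing.compl₁₂ TupleChain.bd LinearMap.id +
      fanPairing.compl₁₂ LinearMap.id TupleChain.bd + (LinearMap.mul (ZMod 2) (ZMod 2)).compl₁₂ ev ev)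
    (fun p q hp hq => fanPairing_single hε p q (hP p hp) (hQ q hq) (hPQ p q hp hq)) hc he

theorem fanPairing_eq_zero {P Q : List (Fin d → ℝ) → Prop}
    (hPQ : ∀ p q, P p → Q q → d + 2 ≤ p.length + q.length)
    {c e : TupleChain (Fin d → ℝ)} (hc : c ∈ TupleChain.supp P) (he : e ∈ TupleChain.supp Q) :
    fanPairing c e = 0 := by
  refine TupleChain.eqOn_supp₂ (g := 0) (fun p q hp hq => ?_) hc he
  change fan (TupleChain.map pairLabel (TupleChain.ez _ _)) = 0
  rw [TupleChain.ez_single]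
  refine TupleChain.eqOn_supp (f := fan ∘ₗ TupleChain.map pairLabel) (g := 0) ?_
    (TupleChain.ezTuple_mem_supp p q)
  rintro l ⟨hl, -⟩
  rw [LinearMap.comp_apply, TupleChain.map_single, fan_eq_zero]
  · rfl
  · have := hPQ p q hp hq
    simp only [Fintype.card_fin, List.length_map]
    omega

/-- A van Kampen type theorem: the skeleton of dimension `⌈d/2⌉` of the simplex on `d + 3` vertices
admits no chain map to `ℝ^d` for which the images of disjoint simplices are far apart. -/
theorem not_almost_embedding {V : Type*} [Fintype V] [DecidableEq V] (hV : Fintype.card V = d + 3)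
    {k : ℕ} (hk : 1 ≤ k) (hdk : d ≤ 2 * k) {ε : ℝ} (hε : 0 < ε)
    (φ : Finset V → TupleChain (Fin d → ℝ)) (K : Finset V → Set (Fin d → ℝ))
    (h0 : φ ∅ = Finsupp.single [] 1)
    (hbd : ∀ σ, σ.card ≤ k + 1 → TupleChain.bd (φ σ) = ∑ v ∈ σ, φ (σ.erase v))
    (hφ : ∀ σ, σ.card ≤ k + 1 → φ σ ∈ TupleChain.supp fun l => l.length = σ.card ∧
      (∀ x ∈ l, ∀ y ∈ l, dist x y < ε) ∧ ∀ x ∈ l, x ∈ K σ)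
    (hK : ∀ σ τ, Disjoint σ τ → ∀ x ∈ K σ, ∀ y ∈ K τ, 2 * ε ≤ dist x y) : False := by
  have hcount : ∀ σ : Finset V, σ.card ≤ k + 1 → TupleChain.bd (φ σ) [] =
      if σ.card = 1 then 1 else 0 := by
    intro σ hσ
    rw [hbd σ hσ, Finsupp.finsetSum_apply]
    split_ifs with h1
    · obtain ⟨v, rfl⟩ := Finset.card_eq_one.1 h1
      simp [h0]
    · refine Finset.sum_eq_zero fun v hv => ?_
      have h2 := Finset.card_erase_add_one hv
      refine (Finsupp.mem_supported' _ _).1 (hφ (σ.erase v) (by omega)) [] fun h => ?_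
      have h3 : 0 = (σ.erase v).card := h.1
      omega
  refine not_pairing (V := V) hk (by omega) (by omega)
    (α := fun σ τ => fanPairing (φ σ) (φ τ)) ?_ ?_ ?_
  · rw [h0]
    change fan (TupleChain.map pairLabel (TupleChain.ez _ _)) = 0
    rw [TupleChain.ez_nil_left, map_zero, map_zero]
  · intro σ τ hd hσ hτ
    have := fanPairing_add_swap hε (fun p hp => hp.2.1) (fun p hp => hp.2.1)
      (fun p q hp hq x hx y hy => hK σ τ hd x (hp.2.2 x hx) y (hq.2.2 y hy)) (hφ σ hσ) (hφ τ hτ)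
    rw [hcount σ hσ, hcount τ hτ, hbd σ hσ, hbd τ hτ, map_sum, map_sum,
      LinearMap.sum_apply] at this
    rw [PairingIdentity, this, ite_and]
    congr 1
    split_ifs <;> simp
  · intro σ τ hd hσ hτ hc
    exact fanPairing_eq_zero (fun p q hp hq => by rw [hp.1, hq.1]; omega) (hφ σ hσ) (hφ τ hτ)

end

section

variable {X : Type*} [DecidableEq X]

/-- Averaging step of the selection: if every `(b + 1)`-subset of `S` contains a related pair, then
some element is related to many others through the same `b`-subset. -/
theorem exists_apex {b m : ℕ} {R : Finset X → X → X → Prop}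
    (hsymm : ∀ T x y, R T x y → R T y x) {S : Finset X}
    (hR : ∀ T ⊆ S, T.card = b + 1 → ∃ x ∈ T, ∃ y ∈ T, x ≠ y ∧ R T x y)
    (hS : b + (b + 1).choose 2 * m < S.card) :
    ∃ A ⊆ S, ∃ s ∈ A, ∃ S' ⊆ S \ A, m < S'.card ∧ ∀ x ∈ S', R (insert x A) s x := by
  have hG : ∀ T, ∃ G : Finset X, T ∈ S.powersetCard (b + 1) →
      ∃ x ∈ T, ∃ y ∈ T, x ≠ y ∧ R T x y ∧ G = {x, y} := fun T => by
    by_cases hT : T ∈ S.powersetCard (b + 1)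
    · rw [Finset.mem_powersetCard] at hT
      obtain ⟨x, hx, y, hy, hxy, h⟩ := hR T hT.1 hT.2
      exact ⟨{x, y}, fun _ => ⟨x, hx, y, hy, hxy, h, rfl⟩⟩
    · exact ⟨∅, fun h => absurd h hT⟩
  choose G hG using hG
  let cnt : Finset X → Finset X := fun A => (S \ A).filter fun x => x ∈ G (insert x A)
  obtain ⟨A, hA, hcnt⟩ : ∃ A ∈ S.powersetCard b, b * m < (cnt A).card := by
    by_contra! hcon
    have h1 : ((S.powersetCard (b + 1)).sigma G).card ≤ ((S.powersetCard b).sigma cnt).card := by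
      refine Finset.card_le_card_of_injOn (fun z => ⟨z.1.erase z.2, z.2⟩) ?_ ?_
      · rintro ⟨T, x⟩ h
        obtain ⟨hT, hx⟩ := Finset.mem_sigma.1 h
        obtain ⟨p, hp, q, hq, -, -, hg⟩ := hG T hT
        have hxT : x ∈ T := by
          simp only [hg, Finset.mem_insert, Finset.mem_singleton] at hx
          rcases hx with rfl | rfl <;> assumption
        rw [Finset.mem_powersetCard] at hT
        simp only [Finset.coe_sigma, Set.mem_sigma_iff, Finset.mem_coe, Finset.mem_powersetCard, cnt,
          Finset.mem_filter, Finset.mem_sdiff]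
        refine ⟨⟨(Finset.erase_subset _ _).trans hT.1, ?_⟩, ⟨hT.1 hxT, Finset.notMem_erase _ _⟩, ?_⟩
        · rw [Finset.card_erase_of_mem hxT, hT.2]; rfl
        · rwa [Finset.insert_erase hxT]
      · rintro ⟨T, x⟩ h ⟨T', x'⟩ h' he
        obtain ⟨hT, hx⟩ := Finset.mem_sigma.1 (Finset.mem_coe.1 h)
        obtain ⟨hT', hx'⟩ := Finset.mem_sigma.1 (Finset.mem_coe.1 h')
        have hsub : ∀ {T : Finset X} {x : X}, T ∈ S.powersetCard (b + 1) → x ∈ G T → x ∈ T := by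
          intro T x hT hx
          obtain ⟨p, hp, q, hq, -, -, hg⟩ := hG T hT
          simp only [hg, Finset.mem_insert, Finset.mem_singleton] at hx
          rcases hx with rfl | rfl <;> assumption
        simp only [Sigma.mk.injEq, heq_eq_eq] at he
        obtain ⟨he, rfl⟩ := he
        have := congrArg (insert x) he
        rw [Finset.insert_erase (hsub hT hx), Finset.insert_erase (hsub hT' hx')] at this
        obtain rfl : T = T' := this
        rfl
    have h2 : ((S.powersetCard (b + 1)).sigma G).card = 2 * S.card.choose (b + 1) := by
      rw [Finset.card_sigma, Finset.sum_congr rfl (g := fun _ => 2), Finset.sum_const,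
        Finset.card_powersetCard, smul_eq_mul, mul_comm]
      intro T hT
      obtain ⟨p, -, q, -, hpq, -, hg⟩ := hG T hT
      rw [hg, Finset.card_pair hpq]
    have h3 : ((S.powersetCard b).sigma cnt).card ≤ S.card.choose b * (b * m) := by
      rw [Finset.card_sigma, ← Finset.card_powersetCard, ← smul_eq_mul]
      exact Finset.sum_le_card_nsmul _ _ _ hcon
    have h4 : S.card.choose (b + 1) * (b + 1) = S.card.choose b * (S.card - b) :=
      Nat.choose_succ_right_eq _ _
    have h5 : 0 < S.card.choose b := Nat.choose_pos (by omega)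
    have h6 : (b + 1).choose 2 * 2 = (b + 1) * b := by
      have := Nat.choose_succ_right_eq (b + 1) 1
      simpa using this
    have h7 : (b + 1).choose 2 * m < S.card - b := by omega
    have h8 : S.card.choose b * ((b + 1).choose 2 * m) < S.card.choose b * (S.card - b) :=
      Nat.mul_lt_mul_of_pos_left h7 h5
    have h9 : S.card.choose b * (b * m) * (b + 1) =
        2 * (S.card.choose b * ((b + 1).choose 2 * m)) := by
      calc _ = S.card.choose b * m * ((b + 1) * b) := by ring
        _ = _ := by rw [← h6]; ring
    have h10 := Nat.mul_le_mul_right (b + 1) (h2 ▸ h1.trans h3)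
    rw [h9, mul_assoc 2, h4] at h10
    omega
  rw [Finset.mem_powersetCard] at hA
  have hf : ∀ x ∈ cnt A, ∃ s ∈ A, R (insert x A) s x := by
    intro x hx
    simp only [cnt, Finset.mem_filter, Finset.mem_sdiff] at hx
    obtain ⟨⟨hxS, hxA⟩, hx⟩ := hx
    obtain ⟨p, hp, q, hq, hpq, hr, hg⟩ := hG (insert x A) (Finset.mem_powersetCard.2
      ⟨Finset.insert_subset hxS hA.1, by rw [Finset.card_insert_of_notMem hxA, hA.2]⟩)
    simp only [hg, Finset.mem_insert, Finset.mem_singleton] at hx hp hq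
    rcases hx with rfl | rfl
    · exact ⟨q, hq.resolve_left hpq.symm, hsymm _ _ _ hr⟩
    · exact ⟨p, hp.resolve_left hpq, hr⟩
  choose! f hf1 hf2 using hf
  obtain ⟨s, hs, hm⟩ := Finset.exists_lt_card_fiber_of_mul_lt_card_of_maps_to hf1
    (by rwa [hA.2])
  refine ⟨A, hA.1, s, hs, _, (Finset.filter_subset _ _).trans (Finset.filter_subset _ _), hm, ?_⟩
  intro x hx
  obtain ⟨hx1, rfl⟩ := Finset.mem_filter.1 hx
  exact hf2 x hx1

/-- Disjoint blocks with representatives that are pairwise related inside the union of their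
blocks. -/
theorem exists_blocks {b : ℕ} {R : Finset X → X → X → Prop}
    (hsymm : ∀ T x y, R T x y → R T y x) (r : ℕ) {S : Finset X}
    (hR : ∀ T ⊆ S, T.card = b + 1 → ∃ x ∈ T, ∃ y ∈ T, x ≠ y ∧ R T x y)
    (hS : b * ∑ j ∈ Finset.range r, (b + 1).choose 2 ^ j < S.card) :
    ∃ (v : Fin (r + 1) → X) (B : Fin (r + 1) → Finset X), (∀ i, B i ⊆ S) ∧ (∀ i, v i ∈ B i) ∧
      (∀ i j, i < j → Disjoint (B i) (B j)) ∧
      ∀ i j, i < j → ∃ T ⊆ B i ∪ B j, R T (v i) (v j) := by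
  induction r generalizing S with
  | zero =>
    obtain ⟨x, hx⟩ := Finset.card_pos.1 (by omega : 0 < S.card)
    exact ⟨fun _ => x, fun _ => {x}, by simpa using hx, by simp, by simp, by simp⟩
  | succ r ih =>
    obtain ⟨A, hA, s, hs, S', hS', hm, hrel⟩ := exists_apex hsymm hR
      (m := b * ∑ j ∈ Finset.range r, (b + 1).choose 2 ^ j) (by
        refine lt_of_eq_of_lt ?_ hS
        rw [Finset.sum_range_succ', Finset.mul_sum, Finset.mul_sum, mul_add, Finset.mul_sum]
        simp only [pow_succ]
        rw [add_comm, pow_zero, mul_one]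
        congr 1
        exact Finset.sum_congr rfl fun _ _ => by ring)
    have hS'S : S' ⊆ S := hS'.trans Finset.sdiff_subset
    obtain ⟨v, B, h1, h2, h3, h4⟩ := ih (fun T hT => hR T (hT.trans hS'S)) hm
    refine ⟨Fin.cons s v, Fin.cons A B, ?_, ?_, ?_, ?_⟩
    · intro i
      cases i using Fin.cases with
      | zero => exact hA
      | succ i => exact (h1 i).trans hS'S
    · intro i
      cases i using Fin.cases with
      | zero => exact hs
      | succ i => exact h2 i
    · intro i j hij
      cases j using Fin.cases with
      | zero => exact absurd hij (Fin.not_lt_zero _)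
      | succ j =>
        cases i using Fin.cases with
        | zero =>
          exact Finset.disjoint_sdiff.mono_right ((h1 j).trans hS')
        | succ i => exact h3 i j (Fin.succ_lt_succ_iff.1 hij)
    · intro i j hij
      cases j using Fin.cases with
      | zero => exact absurd hij (Fin.not_lt_zero _)
      | succ j =>
        cases i using Fin.cases with
        | zero =>
          refine ⟨insert (v j) A, ?_, hrel _ (h1 j (h2 j))⟩
          refine Finset.insert_subset (Finset.mem_union_right _ (h2 j)) Finset.subset_union_left
        | succ i => exact h4 i j (Fin.succ_lt_succ_iff.1 hij)

end

namespace TupleChain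

variable {V : Type*}

theorem bd_mem_length {n : ℕ} {c : TupleChain V} (hc : c ∈ supp fun l => l.length = n + 1) :
    bd c ∈ supp fun l => l.length = n :=
  bd_mem_supp (fun l hl i hi => by rw [List.length_eraseIdx_of_lt hi, hl]; rfl) hc

theorem bd_subset_mem {s : Set V} {n : ℕ} {c : TupleChain V}
    (hc : c ∈ supp fun l => l.length = n + 1 ∧ ∀ x ∈ l, x ∈ s) :
    bd c ∈ supp fun l => l.length = n ∧ ∀ x ∈ l, x ∈ s :=
  bd_mem_supp (fun l hl i hi => ⟨by rw [List.length_eraseIdx_of_lt hi, hl.1]; rfl,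
    fun x hx => hl.2 x (List.mem_of_mem_eraseIdx hx)⟩) hc

section Algebra

variable {E F : Type*} [AddCommGroup E] [Module ℝ E] [AddCommGroup F] [Module ℝ F]

/-- The barycentre of a tuple of points. -/
noncomputable def bary (l : List E) : E := (l.length : ℝ)⁻¹ • l.sum

/-- Barycentric subdivision of chains of tuples of length `n`. -/
noncomputable def subdivide : ℕ → TupleChain E →ₗ[ZMod 2] TupleChain E
  | 0 => LinearMap.id
  | n + 1 => lift fun l => cone (bary l) (subdivide n (bd (Finsupp.single l 1)))

theorem subdivide_succ_single (n : ℕ) (l : List E) : subdivide (n + 1) (Finsupp.single l 1) =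
    cone (bary l) (subdivide n (bd (Finsupp.single l 1))) := by
  rw [subdivide, lift_single]

theorem bd_subdivide (n : ℕ) {c : TupleChain E} (hc : c ∈ supp fun l => l.length = n + 1) :
    bd (subdivide (n + 1) c) = subdivide n (bd c) := by
  have key : ∀ n : ℕ, ∀ l : List E, l.length = n + 1 →
      bd (subdivide (n + 1) (Finsupp.single l 1)) = subdivide n (bd (Finsupp.single l 1)) →
      (bd ∘ₗ subdivide (n + 1)) (Finsupp.single l 1) =
        (subdivide n ∘ₗ bd) (Finsupp.single l (1 : ZMod 2)) := fun _ _ _ h => h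
  induction n generalizing c with
  | zero =>
    have := eqOn_supp (fun l hl => key 0 l hl ?_) hc
    · exact this
    obtain ⟨x, rfl⟩ := List.length_eq_one_iff.1 hl
    rw [subdivide_succ_single, bd_cone]
    simp [subdivide, bd_single_cons]
  | succ n ih =>
    have := eqOn_supp (fun l hl => key (n + 1) l hl ?_) hc
    · exact this
    rw [subdivide_succ_single, bd_cone, ih (bd_mem_length (single_mem_supp hl)), bd_bd, map_zero,
      map_zero, add_zero]

theorem map_subdivide (f : E →ₗ[ℝ] F) (n : ℕ) (c : TupleChain E) :
    map f (subdivide n c) = subdivide n (map f c) := by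
  induction n generalizing c with
  | zero => rfl
  | succ n ih =>
    have : map f ∘ₗ subdivide (n + 1) = subdivide (n + 1) ∘ₗ map f := hom_ext fun l => by
      simp only [LinearMap.comp_apply]
      rw [subdivide_succ_single, map_cone, ih, map_single, subdivide_succ_single, ← map_single,
        bd_map]
      simp [bary, map_list_sum]
    exact LinearMap.congr_fun this c

theorem bary_mem {s : Set E} (hs : Convex ℝ s) {l : List E} (hl : l ≠ []) (h : ∀ x ∈ l, x ∈ s) :
    bary l ∈ s := by
  have hpos : (0 : ℝ) < l.length := by exact_mod_cast List.length_pos_iff.2 hl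
  have : bary l = ∑ i : Fin l.length, (l.length : ℝ)⁻¹ • l[i] := by
    rw [bary, ← Finset.smul_sum]
    congr 1
    simp
  rw [this]
  refine hs.sum_mem (fun _ _ => by positivity) ?_ fun i _ => h _ (List.getElem_mem _)
  simp [hpos.ne']

theorem subdivide_mem {s : Set E} (hs : Convex ℝ s) (n : ℕ) {c : TupleChain E}
    (hc : c ∈ supp fun l => l.length = n ∧ ∀ x ∈ l, x ∈ s) :
    subdivide n c ∈ supp fun l => l.length = n ∧ ∀ x ∈ l, x ∈ s := by
  induction n generalizing c with
  | zero => exact hc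
  | succ n ih =>
    refine map_mem_of_supp (fun l hl => ?_) hc
    rw [subdivide_succ_single]
    refine map_mem_of_supp (fun l' hl' => ?_) (ih (bd_subset_mem (single_mem_supp hl)))
    rw [cone_single]
    refine single_mem_supp ⟨by rw [List.length_cons, hl'.1], ?_⟩
    rintro x hx
    rcases List.mem_cons.1 hx with rfl | hx
    · exact bary_mem hs (by rintro rfl; simp at hl) hl.2
    · exact hl'.2 x hx

theorem iterate_subdivide_mem {s : Set E} (hs : Convex ℝ s) (n N : ℕ) {c : TupleChain E}
    (hc : c ∈ supp fun l => l.length = n ∧ ∀ x ∈ l, x ∈ s) :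
    (subdivide n)^[N] c ∈ supp fun l => l.length = n ∧ ∀ x ∈ l, x ∈ s := by
  induction N with
  | zero => exact hc
  | succ N ih => rw [Function.iterate_succ_apply']; exact subdivide_mem hs n ih

theorem bd_iterate_subdivide (n N : ℕ) {c : TupleChain E}
    (hc : c ∈ supp fun l => l.length = n + 1) :
    bd ((subdivide (n + 1))^[N] c) = (subdivide n)^[N] (bd c) := by
  induction N with
  | zero => rfl
  | succ N ih =>
    rw [Function.iterate_succ_apply', Function.iterate_succ_apply', bd_subdivide, ih]
    have := iterate_subdivide_mem convex_univ (n + 1) N (c := c) (by simpa using hc)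
    simpa using this

theorem map_iterate_subdivide (f : E →ₗ[ℝ] F) (n N : ℕ) (c : TupleChain E) :
    map f ((subdivide n)^[N] c) = (subdivide n)^[N] (map f c) := by
  induction N with
  | zero => rfl
  | succ N ih => rw [Function.iterate_succ_apply', Function.iterate_succ_apply', map_subdivide, ih]

theorem iterate_subdivide_one (N : ℕ) (x : E) :
    (subdivide 1)^[N] (Finsupp.single [x] 1) = Finsupp.single [x] 1 :=
  Function.iterate_fixed (by
    rw [subdivide_succ_single, bd_single_cons]
    simp [subdivide, bary]) N

end Algebra

section Mesh

variable {E : Type*} [NormedAddCommGroup E] [NormedSpace ℝ E]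

theorem dist_bary_le {M : ℕ} {r : ℝ} (hr : 0 ≤ r) {l : List E} (hM : l.length ≤ M)
    (h : ∀ x ∈ l, ∀ y ∈ l, dist x y ≤ r) {x : E} (hx : x ∈ l) :
    dist x (bary l) ≤ (1 - (M : ℝ)⁻¹) * r := by
  obtain ⟨j, rfl⟩ := List.mem_iff_get.1 hx
  have hpos : (0 : ℝ) < l.length := by exact_mod_cast List.length_pos_iff.2 (List.ne_nil_of_mem hx)
  have h1 : l.get j - bary l = (l.length : ℝ)⁻¹ • ∑ i : Fin l.length, (l.get j - l[i]) := by
    rw [Finset.sum_sub_distrib, smul_sub]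
    congr 1
    · simp [← Nat.cast_smul_eq_nsmul ℝ, smul_smul, hpos.ne']
    · rw [bary]
      congr 1
      simp
  have h2 : ‖∑ i : Fin l.length, (l.get j - l[i])‖ ≤ (l.length - 1) * r := by
    rw [← Finset.add_sum_erase _ _ (Finset.mem_univ j)]
    have : l.get j - l[j] = 0 := sub_self _
    rw [this, zero_add]
    refine (norm_sum_le_of_le _ (f := fun i => l.get j - l[i]) (n := fun _ => r) fun i _ => ?_).trans ?_
    · rw [← dist_eq_norm]
      exact h _ hx _ (List.getElem_mem _)
    · rw [Finset.sum_const, Finset.card_erase_of_mem (Finset.mem_univ _), Finset.card_univ,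
        Fintype.card_fin, nsmul_eq_mul, Nat.cast_sub (by exact_mod_cast hpos), Nat.cast_one]
  rw [dist_eq_norm, h1, norm_smul, norm_inv, Real.norm_natCast]
  have h3 : (M : ℝ)⁻¹ ≤ (l.length : ℝ)⁻¹ := inv_anti₀ hpos (by exact_mod_cast hM)
  calc _ ≤ (l.length : ℝ)⁻¹ * ((l.length - 1) * r) := by gcongr
    _ = (1 - (l.length : ℝ)⁻¹) * r := by field_simp
    _ ≤ _ := by gcongr

theorem subdivide_mesh {M n : ℕ} (hn : n ≤ M) {r : ℝ} (hr : 0 ≤ r) {c : TupleChain E}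
    (hc : c ∈ supp fun l => l.length = n ∧ ∀ x ∈ l, ∀ y ∈ l, dist x y ≤ r) :
    subdivide n c ∈ supp fun l => l.length = n ∧ ∀ x ∈ l, ∀ y ∈ l,
      dist x y ≤ (1 - (M : ℝ)⁻¹) * r := by
  induction n generalizing c with
  | zero =>
    refine supp_mono (fun l hl => ⟨hl.1, fun x hx => ?_⟩) hc
    simp [List.length_eq_zero_iff.1 hl.1] at hx
  | succ n ih =>
    refine map_mem_of_supp (fun l hl => ?_) hc
    rw [subdivide_succ_single]
    have hb : bd (Finsupp.single l 1) ∈ supp fun l' => l'.length = n ∧ ∀ x ∈ l', x ∈ l :=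
      bd_subset_mem (s := {x | x ∈ l}) (single_mem_supp ⟨hl.1, fun x hx => hx⟩)
    have h1 := ih (by omega) (supp_mono (fun l' hl' => ⟨hl'.1, fun x hx y hy =>
      hl.2 x (hl'.2 x hx) y (hl'.2 y hy)⟩) hb)
    have h2 := subdivide_mem (convex_closedBall (bary l) ((1 - (M : ℝ)⁻¹) * r)) n
      (supp_mono (fun l' hl' => ⟨hl'.1, fun x hx => Metric.mem_closedBall.2
        (dist_bary_le hr (hl.1 ▸ hn) hl.2 (hl'.2 x hx))⟩) hb)
    have h3 : subdivide n (bd (Finsupp.single l 1)) ∈ supp fun l' => (l'.length = n ∧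
        ∀ x ∈ l', ∀ y ∈ l', dist x y ≤ (1 - (M : ℝ)⁻¹) * r) ∧ (l'.length = n ∧ ∀ x ∈ l',
        x ∈ Metric.closedBall (bary l) ((1 - (M : ℝ)⁻¹) * r)) := by
      intro l' hl'
      exact ⟨h1 hl', h2 hl'⟩
    refine map_mem_of_supp (fun l' hl' => ?_) h3
    rw [cone_single]
    refine single_mem_supp ⟨by rw [List.length_cons, hl'.1.1], ?_⟩
    have h4 : 0 ≤ (1 - (M : ℝ)⁻¹) * r := by
      refine mul_nonneg (sub_nonneg.2 (inv_le_one_of_one_le₀ ?_)) hr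
      exact_mod_cast (by omega : 1 ≤ M)
    intro x hx y hy
    rcases List.mem_cons.1 hx with rfl | hx <;> rcases List.mem_cons.1 hy with rfl | hy
    · rwa [dist_self]
    · rw [dist_comm]; exact hl'.2.2 y hy
    · exact hl'.2.2 x hx
    · exact hl'.1.2 x hx y hy

theorem iterate_subdivide_mesh (n N : ℕ) {r : ℝ} (hr : 0 ≤ r) {c : TupleChain E}
    (hc : c ∈ supp fun l => l.length = n + 1 ∧ ∀ x ∈ l, ∀ y ∈ l, dist x y ≤ r) :
    (subdivide (n + 1))^[N] c ∈ supp fun l => l.length = n + 1 ∧ ∀ x ∈ l, ∀ y ∈ l,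
      dist x y ≤ (1 - ((n + 1 : ℕ) : ℝ)⁻¹) ^ N * r := by
  have h0 : (0 : ℝ) ≤ 1 - ((n + 1 : ℕ) : ℝ)⁻¹ := by
    refine sub_nonneg.2 (inv_le_one_of_one_le₀ ?_)
    exact_mod_cast (by omega : 1 ≤ n + 1)
  induction N with
  | zero => simpa using hc
  | succ N ih =>
    rw [Function.iterate_succ_apply', pow_succ', mul_assoc]
    exact subdivide_mesh le_rfl (by positivity) ih

end Mesh

end TupleChain

namespace TupleChain

/-- The tuple of vertices of the standard simplex. -/
noncomputable def simplexVertices (m : ℕ) : List (Fin (m + 1) → ℝ) :=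
  List.ofFn fun i => Pi.single i 1

theorem map_simplexVertices (m : ℕ) (i : Fin (m + 2)) :
    (simplexVertices m).map (FunOnFinite.linearMap ℝ ℝ i.succAbove) =
      (simplexVertices (m + 1)).eraseIdx i := by
  refine List.ext_getElem ?_ fun j h1 h2 => ?_
  · rw [List.length_eraseIdx_of_lt (by have := i.2; simp [simplexVertices]; omega)]
    simp [simplexVertices]
  · have hj : j < m + 1 := by simpa [simplexVertices] using h1
    simp only [simplexVertices, List.getElem_map, List.getElem_ofFn, List.getElem_eraseIdx]
    rw [FunOnFinite.linearMap_piSingle]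
    by_cases hji : j < i
    · rw [dif_pos hji, Fin.succAbove_of_castSucc_lt _ _ (by simpa [Fin.lt_def] using hji)]
      rfl
    · rw [dif_neg hji, Fin.succAbove_of_le_castSucc _ _ (by simpa [Fin.le_def] using hji)]
      rfl

theorem mem_simplexVertices {m : ℕ} {x : Fin (m + 1) → ℝ} (hx : x ∈ simplexVertices m) :
    x ∈ stdSimplex ℝ (Fin (m + 1)) := by
  obtain ⟨i, rfl⟩ := List.mem_ofFn.1 hx
  exact single_mem_stdSimplex ℝ i

/-- The iterated barycentric subdivision of the standard simplex. -/
noncomputable def simplexSubdivision (N m : ℕ) : TupleChain (Fin (m + 1) → ℝ) :=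
  (subdivide (m + 1))^[N] (Finsupp.single (simplexVertices m) 1)

theorem simplexSubdivision_mem (N m : ℕ) : simplexSubdivision N m ∈ supp fun l =>
    l.length = m + 1 ∧ ∀ x ∈ l, x ∈ stdSimplex ℝ (Fin (m + 1)) :=
  iterate_subdivide_mem (convex_stdSimplex ℝ _) _ _
    (single_mem_supp ⟨by simp [simplexVertices], fun _ => mem_simplexVertices⟩)

theorem simplexSubdivision_mesh (N m : ℕ) : simplexSubdivision N m ∈ supp fun l =>
    l.length = m + 1 ∧ ∀ x ∈ l, ∀ y ∈ l, dist x y ≤ (1 - ((m + 1 : ℕ) : ℝ)⁻¹) ^ N * 1 := by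
  refine iterate_subdivide_mesh m N zero_le_one
    (single_mem_supp ⟨by simp [simplexVertices], fun x hx y hy => ?_⟩)
  exact (Metric.dist_le_diam_of_mem (bounded_stdSimplex _) (mem_simplexVertices hx)
    (mem_simplexVertices hy)).trans diam_stdSimplex_le

theorem bd_simplexSubdivision (N m : ℕ) : bd (simplexSubdivision N (m + 1)) =
    ∑ i : Fin (m + 2), map (FunOnFinite.linearMap ℝ ℝ i.succAbove) (simplexSubdivision N m) := by
  rw [simplexSubdivision, bd_iterate_subdivide _ _ (single_mem_supp (by simp [simplexVertices])),
    bd_single_eq_sum]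
  have hlen : (simplexVertices (m + 1)).length = m + 2 := by simp [simplexVertices]
  have hsum : ∀ c : TupleChain (Fin (m + 2) → ℝ), (subdivide (m + 1))^[N] c =
      (subdivide (m + 1) ^ N) c := fun c => by rw [Module.End.pow_apply]
  rw [hsum, map_sum, ← (finCongr hlen).symm.sum_comp]
  refine Finset.sum_congr rfl fun i _ => ?_
  rw [simplexSubdivision, map_iterate_subdivide, map_single, map_simplexVertices, hsum]
  rfl

theorem map_congr {V W : Type*} {s : Set V} {f g : V → W} (h : Set.EqOn f g s) {c : TupleChain V}
    (hc : c ∈ supp fun l => ∀ x ∈ l, x ∈ s) : map f c = map g c :=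
  eqOn_supp (fun l hl => by
    rw [map_single, map_single, List.map_congr_left fun x hx => h (hl x hx)]) hc

variable {X : Type*} [TopologicalSpace X]

/-- The union of the images of the simplices of a singular chain. -/
def carrier {m : ℕ} (c : C(stdSimplex ℝ (Fin (m + 1)), X) →₀ ZMod 2) : Set X :=
  ⋃ s ∈ c.support, Set.range s

theorem isCompact_carrier {m : ℕ} (c : C(stdSimplex ℝ (Fin (m + 1)), X) →₀ ZMod 2) :
    IsCompact (carrier c) :=
  c.support.isCompact_biUnion fun s _ => isCompact_range s.continuous

variable [Zero X]

/-- The tuple chain of the points of a subdivided singular simplex. -/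
noncomputable def sampleSimplex (N m : ℕ) (s : C(stdSimplex ℝ (Fin (m + 1)), X)) : TupleChain X :=
  map (Function.extend Subtype.val s 0) (simplexSubdivision N m)

/-- Sampling of singular chains. -/
noncomputable def sample (N m : ℕ) :
    (C(stdSimplex ℝ (Fin (m + 1)), X) →₀ ZMod 2) →ₗ[ZMod 2] TupleChain X :=
  Finsupp.linearCombination (ZMod 2) (sampleSimplex N m)

theorem bd_sample (N m : ℕ) (c : C(stdSimplex ℝ (Fin (m + 2)), X) →₀ ZMod 2) :
    bd (sample N (m + 1) c) = sample N m (singBd X m c) := by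
  have : bd ∘ₗ sample N (m + 1) = sample N m ∘ₗ singBd X m := by
    ext1 s
    ext1
    simp only [LinearMap.comp_apply, Finsupp.lsingle_apply, singBd, LinearMap.sum_apply,
      Finsupp.lmapDomain_apply, Finsupp.mapDomain_single, map_sum]
    simp only [sample, Finsupp.linearCombination_single, one_smul]
    rw [sampleSimplex, bd_map, bd_simplexSubdivision, map_sum]
    refine Finset.sum_congr rfl fun i _ => ?_
    rw [map_map, sampleSimplex]
    refine map_congr (s := stdSimplex ℝ (Fin (m + 1))) (fun x hx => ?_)
      (supp_mono (fun l hl => hl.2) (simplexSubdivision_mem N m))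
    have h1 := Subtype.val_injective.extend_apply (singFace i s) 0 ⟨x, hx⟩
    have h2 := Subtype.val_injective.extend_apply s 0 (stdSimplex.map i.succAbove ⟨x, hx⟩)
    exact h2.trans h1.symm
  exact LinearMap.congr_fun this c

theorem sample_const (N : ℕ) (p : X) :
    sample N 0 (Finsupp.single (ContinuousMap.const _ p) 1) = Finsupp.single [p] 1 := by
  rw [sample, Finsupp.linearCombination_single, one_smul, sampleSimplex, simplexSubdivision]
  have h : simplexVertices 0 = [Pi.single 0 1] := by simp [simplexVertices]
  rw [h, iterate_subdivide_one, map_single]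
  have h1 := Subtype.val_injective.extend_apply
    (ContinuousMap.const (stdSimplex ℝ (Fin 1)) p) 0 ⟨_, single_mem_stdSimplex ℝ 0⟩
  rw [List.map_singleton, h1]
  rfl

end TupleChain

namespace TupleChain

variable {X : Type*} [PseudoMetricSpace X] [Zero X]

theorem eventually_sampleSimplex_mem {m : ℕ} (s : C(stdSimplex ℝ (Fin (m + 1)), X)) {ε : ℝ}
    (hε : 0 < ε) : ∀ᶠ N in Filter.atTop, sampleSimplex N m s ∈ supp fun l => l.length = m + 1 ∧
      (∀ x ∈ l, ∀ y ∈ l, dist x y < ε) ∧ ∀ x ∈ l, x ∈ Set.range s := by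
  have hu : UniformContinuous s := CompactSpace.uniformContinuous_of_continuous s.continuous
  obtain ⟨δ, hδ, hs⟩ := Metric.uniformContinuous_iff.1 hu ε hε
  have h0 : (0 : ℝ) ≤ 1 - ((m + 1 : ℕ) : ℝ)⁻¹ := by
    refine sub_nonneg.2 (inv_le_one_of_one_le₀ ?_)
    exact_mod_cast (by omega : 1 ≤ m + 1)
  have h1 : 1 - ((m + 1 : ℕ) : ℝ)⁻¹ < 1 := by
    have : (0 : ℝ) < ((m + 1 : ℕ) : ℝ)⁻¹ := by positivity
    linarith
  filter_upwards [(tendsto_pow_atTop_nhds_zero_of_lt_one h0 h1).eventually (gt_mem_nhds hδ)]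
    with N hN
  have hmem : simplexSubdivision N m ∈ supp fun l =>
      (l.length = m + 1 ∧ ∀ x ∈ l, x ∈ stdSimplex ℝ (Fin (m + 1))) ∧
      (l.length = m + 1 ∧ ∀ x ∈ l, ∀ y ∈ l, dist x y ≤ (1 - ((m + 1 : ℕ) : ℝ)⁻¹) ^ N * 1) :=
    fun l hl => ⟨simplexSubdivision_mem N m hl, simplexSubdivision_mesh N m hl⟩
  refine map_mem_of_supp (fun l hl => ?_) hmem
  rw [map_single]
  have hext : ∀ x (hx : x ∈ l), Function.extend Subtype.val s 0 x = s ⟨x, hl.1.2 x hx⟩ :=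
    fun x hx => Subtype.val_injective.extend_apply s 0 ⟨x, hl.1.2 x hx⟩
  refine single_mem_supp ⟨by rw [List.length_map, hl.1.1], ?_, ?_⟩
  · intro x hx y hy
    obtain ⟨x', hx', rfl⟩ := List.mem_map.1 hx
    obtain ⟨y', hy', rfl⟩ := List.mem_map.1 hy
    rw [hext x' hx', hext y' hy']
    refine hs ?_
    rw [Subtype.dist_eq]
    refine (hl.2.2 x' hx' y' hy').trans_lt ?_
    rwa [mul_one]
  · intro x hx
    obtain ⟨x', hx', rfl⟩ := List.mem_map.1 hx
    rw [hext x' hx']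
    exact Set.mem_range_self _

theorem eventually_sample_mem {m : ℕ} (c : C(stdSimplex ℝ (Fin (m + 1)), X) →₀ ZMod 2) {ε : ℝ}
    (hε : 0 < ε) : ∀ᶠ N in Filter.atTop, sample N m c ∈ supp fun l => l.length = m + 1 ∧
      (∀ x ∈ l, ∀ y ∈ l, dist x y < ε) ∧ ∀ x ∈ l, x ∈ carrier c := by
  have h : ∀ᶠ N in Filter.atTop, ∀ s ∈ c.support, sampleSimplex N m s ∈ supp fun l =>
      l.length = m + 1 ∧ (∀ x ∈ l, ∀ y ∈ l, dist x y < ε) ∧ ∀ x ∈ l, x ∈ Set.range s :=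
    (Filter.eventually_all_finset _).2 fun s _ => eventually_sampleSimplex_mem s hε
  filter_upwards [h] with N hN
  rw [sample, Finsupp.linearCombination_apply]
  refine Submodule.sum_mem _ fun s hs => Submodule.smul_mem _ _ ?_
  exact supp_mono (fun l hl => ⟨hl.1, hl.2.1, fun x hx => Set.mem_biUnion hs (hl.2.2 x hx)⟩)
    (hN s hs)

end TupleChain

section

variable {X Y : Type*} [TopologicalSpace X] [TopologicalSpace Y]

theorem singBd_single (n : ℕ) (s : C(stdSimplex ℝ (Fin (n + 2)), X)) (a : ZMod 2) :
    singBd X n (Finsupp.single s a) = ∑ i, Finsupp.single (singFace i s) a := by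
  rw [singBd, LinearMap.sum_apply]
  exact Finset.sum_congr rfl fun i _ => Finsupp.mapDomain_single

/-- The pushforward of singular chains along a continuous map. -/
noncomputable def singMap (f : C(X, Y)) (n : ℕ) :
    (C(stdSimplex ℝ (Fin (n + 1)), X) →₀ ZMod 2) →ₗ[ZMod 2]
      (C(stdSimplex ℝ (Fin (n + 1)), Y) →₀ ZMod 2) :=
  Finsupp.lmapDomain _ _ f.comp

theorem singMap_single (f : C(X, Y)) (n : ℕ) (s : C(stdSimplex ℝ (Fin (n + 1)), X)) (a : ZMod 2) :
    singMap f n (Finsupp.single s a) = Finsupp.single (f.comp s) a :=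
  Finsupp.mapDomain_single

theorem singBd_singMap (f : C(X, Y)) (n : ℕ) (c : C(stdSimplex ℝ (Fin (n + 2)), X) →₀ ZMod 2) :
    singBd Y n (singMap f (n + 1) c) = singMap f n (singBd X n c) := by
  induction c using Finsupp.induction_linear with
  | zero => simp only [map_zero]
  | add f g hf hg => simp only [map_add, hf, hg]
  | single s a =>
    rw [singBd_single, map_sum, singMap_single, singBd_single]
    exact Finset.sum_congr rfl fun i _ => (singMap_single f n (singFace i s) a).symm

/-- The singular chains carried by a set. -/
def singChainsIn (A : Set X) (n : ℕ) :
    Submodule (ZMod 2) (C(stdSimplex ℝ (Fin (n + 1)), X) →₀ ZMod 2) :=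
  Finsupp.supported _ _ {s | Set.range s ⊆ A}

theorem singChainsIn_mono {A B : Set X} (h : A ⊆ B) (n : ℕ) :
    singChainsIn A n ≤ singChainsIn B n :=
  Finsupp.supported_mono fun _ hs => hs.trans h

theorem single_mem_singChainsIn {A : Set X} {n : ℕ} {s : C(stdSimplex ℝ (Fin (n + 1)), X)}
    (h : ∀ t, s t ∈ A) : Finsupp.single s 1 ∈ singChainsIn A n :=
  Finsupp.single_mem_supported _ _ (Set.range_subset_iff.2 h)

/-- The inclusion of a subset as a continuous map. -/
def inclusionMap (A : Set X) : C(A, X) := ⟨Subtype.val, continuous_subtype_val⟩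

theorem singMap_mem (A : Set X) (n : ℕ) (c : C(stdSimplex ℝ (Fin (n + 1)), A) →₀ ZMod 2) :
    singMap (inclusionMap A) n c ∈ singChainsIn A n := by
  induction c using Finsupp.induction_linear with
  | zero => rw [map_zero]; exact zero_mem _
  | add f g hf hg => rw [map_add]; exact add_mem hf hg
  | single s a =>
    rw [singMap_single]
    exact Finsupp.single_mem_supported _ _ (Set.range_subset_iff.2 fun t => (s t).2)

theorem exists_singMap_eq {A : Set X} {n : ℕ} {c : C(stdSimplex ℝ (Fin (n + 1)), X) →₀ ZMod 2}
    (hc : c ∈ singChainsIn A n) : ∃ e, singMap (inclusionMap A) n e = c := by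
  have h : {s : C(stdSimplex ℝ (Fin (n + 1)), X) | Set.range s ⊆ A} ⊆
      (inclusionMap A).comp '' Set.univ := fun s hs =>
    ⟨⟨fun t => ⟨s t, hs (Set.mem_range_self t)⟩, by fun_prop⟩, trivial, rfl⟩
  have := Finsupp.supported_mono (R := ZMod 2) (M := ZMod 2) h hc
  rw [← Finsupp.lmapDomain_supported] at this
  obtain ⟨e, -, he⟩ := this
  exact ⟨e, he⟩

theorem singMap_injective (A : Set X) (n : ℕ) : Function.Injective (singMap (inclusionMap A) n) :=
  Finsupp.mapDomain_injective fun _ _ h => ContinuousMap.ext fun x =>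
    Subtype.ext (ContinuousMap.congr_fun h x)

theorem exists_singBd_eq_of_mem {X : Type} [TopologicalSpace X] {A : Set X} (n : ℕ)
    (h : Subsingleton (SingularHomology (ZMod 2) A (n + 1)))
    {c : C(stdSimplex ℝ (Fin (n + 2)), X) →₀ ZMod 2} (hc : c ∈ singChainsIn A (n + 1))
    (hbd : singBd X n c = 0) : ∃ e ∈ singChainsIn A (n + 2), singBd X (n + 1) e = c := by
  obtain ⟨c, rfl⟩ := exists_singMap_eq hc
  rw [singBd_singMap] at hbd
  obtain ⟨e, rfl⟩ := exists_singBd_eq A n h c (singMap_injective A n (hbd.trans (map_zero _).symm))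
  exact ⟨_, singMap_mem A _ e, singBd_singMap _ _ _⟩

theorem exists_singBd_path {A : Set X} {x y : X} (h : JoinedIn A x y) :
    ∃ e ∈ singChainsIn A 1, singBd X 0 e =
      Finsupp.single (ContinuousMap.const _ y) 1 + Finsupp.single (ContinuousMap.const _ x) 1 := by
  let s : C(stdSimplex ℝ (Fin 2), X) :=
    h.somePath.toContinuousMap.comp ⟨stdSimplexHomeomorphUnitInterval, by fun_prop⟩
  refine ⟨Finsupp.single s 1, single_mem_singChainsIn fun t => h.somePath_mem _, ?_⟩
  have hv : ∀ t : stdSimplex ℝ (Fin 1), t = stdSimplex.vertex 0 := fun t => Subsingleton.elim _ _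
  rw [singBd_single, Fin.sum_univ_two]
  congr 2
  · ext t
    rw [hv t]
    change h.somePath (stdSimplexHomeomorphUnitInterval (stdSimplex.map _ _)) = y
    rw [stdSimplex.map_vertex]
    exact h.somePath.target
  · ext t
    rw [hv t]
    change h.somePath (stdSimplexHomeomorphUnitInterval (stdSimplex.map _ _)) = x
    rw [stdSimplex.map_vertex]
    exact h.somePath.source

theorem exists_singular_fillings {X : Type} [TopologicalSpace X] {V : Type*} [DecidableEq V]
    {G : Finset V → Set X} (hG : Monotone G) {p : V → X} (hp : ∀ i, p i ∈ G {i})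
    (hj : ∀ i j, i ≠ j → JoinedIn (G {i, j}) (p i) (p j)) (k : ℕ)
    (hhom : ∀ σ m, 1 ≤ m → m ≤ k → σ.card = m + 2 →
      Subsingleton (SingularHomology (ZMod 2) (G σ) m)) :
    ∃ ψ : ∀ m : ℕ, Finset V → (C(stdSimplex ℝ (Fin (m + 1)), X) →₀ ZMod 2),
      (∀ i, ψ 0 {i} = Finsupp.single (ContinuousMap.const _ (p i)) 1) ∧
      (∀ m ≤ k + 1, ∀ σ, σ.card = m + 1 → ψ m σ ∈ singChainsIn (G σ) m) ∧
      ∀ m ≤ k, ∀ σ, σ.card = m + 2 →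
        singBd X m (ψ (m + 1) σ) = ∑ v ∈ σ, ψ m (σ.erase v) := by
  induction k with
  | zero =>
    let ψ₀ : Finset V → (C(stdSimplex ℝ (Fin 1), X) →₀ ZMod 2) := fun σ =>
      ∑ i ∈ σ, Finsupp.single (ContinuousMap.const _ (p i)) 1
    have h1 : ∀ σ : Finset V, ∃ e : C(stdSimplex ℝ (Fin 2), X) →₀ ZMod 2, σ.card = 2 →
        e ∈ singChainsIn (G σ) 1 ∧ singBd X 0 e = ∑ v ∈ σ, ψ₀ (σ.erase v) := by
      intro σ
      by_cases hσ : σ.card = 2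
      · obtain ⟨i, j, hij, rfl⟩ := Finset.card_eq_two.1 hσ
        obtain ⟨e, he, hbd⟩ := exists_singBd_path (hj i j hij)
        refine ⟨e, fun _ => ⟨he, ?_⟩⟩
        rw [hbd, Finset.sum_pair hij]
        have e1 : ({i, j} : Finset V).erase i = {j} := by ext; simp; grind
        have e2 : ({i, j} : Finset V).erase j = {i} := by ext; simp; grind
        simp only [ψ₀, e1, e2, Finset.sum_singleton]
      · exact ⟨0, fun h => absurd h hσ⟩
    choose ψ₁ hψ₁ using h1
    refine ⟨fun m => match m with
      | 0 => ψ₀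
      | 1 => ψ₁
      | _ + 2 => 0, fun i => Finset.sum_singleton _ _, fun m hm σ hσ => ?_, fun m hm σ hσ => ?_⟩
    · match m, hm with
      | 0, _ =>
        obtain ⟨i, rfl⟩ := Finset.card_eq_one.1 hσ
        change ψ₀ {i} ∈ _
        simp only [ψ₀, Finset.sum_singleton]
        exact single_mem_singChainsIn fun _ => hp i
      | 1, _ => exact (hψ₁ σ hσ).1
    · obtain rfl : m = 0 := by omega
      exact (hψ₁ σ hσ).2
  | succ k ih =>
    obtain ⟨ψ, h0, hin, hbd⟩ := ih fun σ m h1 h2 => hhom σ m h1 (h2.trans k.le_succ)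
    have hcyc : ∀ σ : Finset V, ∃ e : C(stdSimplex ℝ (Fin (k + 3)), X) →₀ ZMod 2,
        σ.card = k + 3 →
        e ∈ singChainsIn (G σ) (k + 2) ∧ singBd X (k + 1) e = ∑ v ∈ σ, ψ (k + 1) (σ.erase v) := by
      intro σ
      by_cases hσ : σ.card = k + 3
      · have hc : ∀ v ∈ σ, (σ.erase v).card = k + 2 := fun v hv => by
          rw [Finset.card_erase_of_mem hv, hσ]; rfl
        obtain ⟨e, he⟩ := exists_singBd_eq_of_mem k (hhom σ (k + 1) (by omega) le_rfl hσ)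
          (Submodule.sum_mem _ fun v hv => singChainsIn_mono (hG (Finset.erase_subset v σ)) _
            (hin (k + 1) le_rfl _ (hc v hv))) (by
          rw [map_sum, Finset.sum_congr rfl fun v hv => hbd k le_rfl _ (hc v hv)]
          exact sum_erase_erase σ (ψ k))
        exact ⟨e, fun _ => he⟩
      · exact ⟨0, fun h => absurd h hσ⟩
    choose χ hχ using hcyc
    refine ⟨Function.update ψ (k + 2) χ, fun i => ?_, fun m hm σ hσ => ?_, fun m hm σ hσ => ?_⟩
    · rw [Function.update_of_ne (by omega), h0]
    · rcases Nat.lt_or_eq_of_le hm with h | rfl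
      · rw [Function.update_of_ne (by omega)]
        exact hin m (by omega) σ hσ
      · rw [Function.update_self]
        exact (hχ σ hσ).1
    · rcases Nat.lt_or_eq_of_le hm with h | rfl
      · rw [Function.update_of_ne (by omega), Function.update_of_ne (by omega)]
        exact hbd m (by omega) σ hσ
      · rw [Function.update_self, Function.update_of_ne (by omega)]
        exact (hχ σ hσ).2

end

section

open TupleChain

theorem carrier_subset {X : Type*} [TopologicalSpace X] {A : Set X} {m : ℕ}
    {c : C(stdSimplex ℝ (Fin (m + 1)), X) →₀ ZMod 2} (hc : c ∈ singChainsIn A m) :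
    carrier c ⊆ A :=
  Set.iUnion₂_subset fun _ hs => hc hs

theorem exists_uniform_gap {X ι : Type*} [PseudoMetricSpace X] [Finite ι] {r : ι → ι → Prop}
    {K : ι → Set X} (hK : ∀ i, IsCompact (K i)) (hcl : ∀ i, IsClosed (K i))
    (h : ∀ i j, r i j → Disjoint (K i) (K j)) :
    ∃ ε > 0, ∀ i j, r i j → ∀ x ∈ K i, ∀ y ∈ K j, 2 * ε ≤ dist x y := by
  have key : ∀ᶠ ε : ℝ in nhdsWithin 0 (Set.Ioi 0),
      ∀ i j, r i j → ∀ x ∈ K i, ∀ y ∈ K j, 2 * ε ≤ dist x y := by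
    refine Filter.eventually_all.2 fun i => Filter.eventually_all.2 fun j => ?_
    by_cases hij : r i j
    · obtain ⟨δ, hδ, hd⟩ := Metric.exists_pos_forall_lt_edist (hK i) (hcl j) (h i j hij)
      filter_upwards [Ioo_mem_nhdsGT (show (0 : ℝ) < δ / 2 by positivity)] with ε hε _ x hx y hy
      have h1 : (δ : ℝ) < dist x y := by
        have := hd x hx y hy
        rw [edist_nndist, ENNReal.coe_lt_coe] at this
        exact_mod_cast this
      linarith [hε.2]
    · exact Filter.Eventually.of_forall fun ε h => absurd h hij
  obtain ⟨ε, hε, h0⟩ := (key.and self_mem_nhdsWithin).exists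
  exact ⟨ε, h0, hε⟩

theorem not_disjoint_acyclic_system {d : ℕ} [NeZero d] {V : Type*} [Fintype V] [DecidableEq V]
    (hV : Fintype.card V = d + 3) {G : Finset V → Set (Fin d → ℝ)} (hG : Monotone G)
    {p : V → Fin d → ℝ} (hp : ∀ i, p i ∈ G {i})
    (hj : ∀ i j, i ≠ j → JoinedIn (G {i, j}) (p i) (p j))
    (hhom : ∀ σ m, 1 ≤ m → m ≤ (d + 1) / 2 - 1 → σ.card = m + 2 →
      Subsingleton (SingularHomology (ZMod 2) (G σ) m))
    (hdisj : ∀ σ τ, Disjoint σ τ → Disjoint (G σ) (G τ)) : False := by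
  have hd : 1 ≤ d := NeZero.one_le
  obtain ⟨k, hk⟩ : ∃ k, (d + 1) / 2 = k + 1 := ⟨(d + 1) / 2 - 1, by omega⟩
  rw [hk, Nat.add_sub_cancel] at hhom
  obtain ⟨ψ, h0, hin, hbd⟩ := exists_singular_fillings hG hp hj k hhom
  let c : ∀ σ : Finset V, C(stdSimplex ℝ (Fin (σ.card - 1 + 1)), Fin d → ℝ) →₀ ZMod 2 :=
    fun σ => if σ.card ≤ k + 2 ∧ σ ≠ ∅ then ψ (σ.card - 1) σ else 0
  have hc : ∀ σ, c σ ∈ singChainsIn (G σ) _ := by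
    intro σ
    by_cases h : σ.card ≤ k + 2 ∧ σ ≠ ∅
    · simp only [c, if_pos h]
      have := Finset.card_pos.2 (Finset.nonempty_iff_ne_empty.2 h.2)
      exact hin _ (by omega) _ (by omega)
    · simp only [c, if_neg h]
      exact zero_mem _
  obtain ⟨ε, hε, hK⟩ := exists_uniform_gap (r := Disjoint) (fun σ => isCompact_carrier (c σ))
    (fun σ => (isCompact_carrier (c σ)).isClosed)
    (fun σ τ h => (hdisj σ τ h).mono (carrier_subset (hc σ)) (carrier_subset (hc τ)))
  obtain ⟨N, hN⟩ := (Filter.eventually_all.2 fun σ => eventually_sample_mem (c σ) hε).exists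
  refine not_almost_embedding hV (k := k + 1) (by omega) (by omega) hε
    (fun σ => if σ = ∅ then Finsupp.single [] 1 else sample N (σ.card - 1) (c σ))
    (fun σ => carrier (c σ)) (if_pos rfl) (fun σ hσ => ?_) (fun σ hσ => ?_) hK
  · obtain h | ⟨m, hm⟩ : σ.card = 0 ∨ ∃ m, σ.card = m + 1 := by
      rcases h : σ.card with _ | m
      exacts [Or.inl rfl, Or.inr ⟨m, rfl⟩]
    · obtain rfl := Finset.card_eq_zero.1 h
      simp
    have hφ : ∀ (τ : Finset V) (n : ℕ), τ.card = n + 1 → n ≤ k + 1 →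
        (if τ = ∅ then Finsupp.single [] 1 else sample N (τ.card - 1) (c τ)) =
          sample N n (ψ n τ) := by
      intro τ n hτ hn
      have hne : τ ≠ ∅ := by rintro rfl; simp at hτ
      obtain rfl : n = τ.card - 1 := by omega
      rw [if_neg hne]
      simp only [c]
      rw [if_pos ⟨by omega, hne⟩]
    rw [hφ σ m hm (by omega)]
    rcases m with _ | m
    · obtain ⟨i, rfl⟩ := Finset.card_eq_one.1 hm
      rw [h0, sample_const]
      simp [bd_single_cons]
    · rw [bd_sample, hbd m (by omega) σ hm, map_sum]
      refine Finset.sum_congr rfl fun v hv => (hφ _ m ?_ (by omega)).symm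
      rw [Finset.card_erase_of_mem hv, hm]
      rfl
  · split_ifs with h
    · subst h
      exact single_mem_supp ⟨rfl, by simp, by simp⟩
    · have := Finset.card_pos.2 (Finset.nonempty_iff_ne_empty.2 h)
      exact supp_mono (fun l hl => ⟨hl.1.trans (by omega), hl.2⟩) (hN σ)

theorem exists_joinedIn_of_card_zerothHomotopy_lt {X ι : Type*} [TopologicalSpace X] {A : Set X}
    {b : ℕ} (hfin : Finite (ZerothHomotopy A)) (hb : Nat.card (ZerothHomotopy A) ≤ b)
    {T : Finset ι} (hT : b < T.card) {p : ι → X} (hp : ∀ i ∈ T, p i ∈ A) :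
    ∃ i ∈ T, ∃ j ∈ T, i ≠ j ∧ JoinedIn A (p i) (p j) := by
  have := Fintype.ofFinite (ZerothHomotopy A)
  obtain ⟨i, j, hij, h⟩ := Fintype.exists_ne_map_eq_of_card_lt
    (fun i : T => ZerothHomotopy.mk (⟨p i, hp i i.2⟩ : A)) (by
      rw [Fintype.card_coe, ← Nat.card_eq_fintype_card]
      exact hb.trans_lt hT)
  exact ⟨i, i.2, j, j.2, fun h => hij (Subtype.ext h),
    (joinedIn_iff_joined (hp i i.2) (hp j j.2)).2 (Quotient.exact h)⟩

end

/-- **Polynomial Helly number bound of Jelínek, Paták and Patáková.**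
Let `b, d ≥ 1` and let `ℱ` be a finite family of subsets of `ℝ^d` such that the
intersection of every nonempty subfamily has at most `b` path-connected components and
vanishing `ℤ₂` singular homology in all degrees `1 ≤ i ≤ ⌈d/2⌉ − 1`. If `⋂ℱ = ∅`,
then some subfamily with at most `b·∑_{j=0}^{d+1} C(b+1,2)^j` members has empty
intersection. -/
theorem polynomial_helly_bound
    (b d : ℕ) (hb : 1 ≤ b) (hd : 1 ≤ d)
    (ℱ : Finset (Set (Fin d → ℝ)))
    (hcomp : ∀ 𝒢 : Finset (Set (Fin d → ℝ)), 𝒢 ⊆ ℱ → 𝒢.Nonempty →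
      Finite (ZerothHomotopy ↥(⋂₀ (𝒢 : Set (Set (Fin d → ℝ))))) ∧
      Nat.card (ZerothHomotopy ↥(⋂₀ (𝒢 : Set (Set (Fin d → ℝ))))) ≤ b)
    (hhom : ∀ 𝒢 : Finset (Set (Fin d → ℝ)), 𝒢 ⊆ ℱ → 𝒢.Nonempty →
      ∀ i : ℕ, 1 ≤ i → i ≤ (d + 1) / 2 - 1 →
        Subsingleton (SingularHomology (ZMod 2)
          ↥(⋂₀ (𝒢 : Set (Set (Fin d → ℝ)))) i))
    (hempty : ⋂₀ (ℱ : Set (Set (Fin d → ℝ))) = ∅) :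
    ∃ 𝒢 ⊆ ℱ, 𝒢.card ≤ b * ∑ j ∈ Finset.range (d + 2), ((b + 1).choose 2) ^ j ∧
      ⋂₀ (𝒢 : Set (Set (Fin d → ℝ))) = ∅ := by
    classical
  have : NeZero d := ⟨by omega⟩
  obtain ⟨𝒢, h𝒢, hmin⟩ := Finset.exists_min_image
    (ℱ.powerset.filter fun 𝒢 : Finset (Set (Fin d → ℝ)) => ⋂₀ (𝒢 : Set (Set (Fin d → ℝ))) = ∅)
    Finset.card
    ⟨ℱ, by simpa using hempty⟩
  rw [Finset.mem_filter, Finset.mem_powerset] at h𝒢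
  obtain ⟨hsub, hem⟩ := h𝒢
  refine ⟨𝒢, hsub, ?_, hem⟩
  by_contra! hcard
  have hp : ∀ x, ∃ q : Fin d → ℝ, x ∈ 𝒢 → q ∈ ⋂₀ ((𝒢.erase x : Finset _) : Set (Set _)) := by
    intro x
    by_cases hx : x ∈ 𝒢
    · have : (⋂₀ ((𝒢.erase x : Finset _) : Set (Set (Fin d → ℝ)))).Nonempty := by
        rw [Set.nonempty_iff_ne_empty]
        intro h
        have := hmin (𝒢.erase x) (by
          rw [Finset.mem_filter, Finset.mem_powerset]
          exact ⟨(Finset.erase_subset _ _).trans hsub, h⟩)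
        exact absurd (Finset.card_erase_lt_of_mem hx) (by omega)
      exact this.imp fun q hq _ => hq
    · exact ⟨0, fun h => absurd h hx⟩
  choose p hp using hp
  let U : Finset (Set (Fin d → ℝ)) → Set (Fin d → ℝ) := fun T =>
    ⋂₀ ((𝒢 \ T : Finset _) : Set (Set (Fin d → ℝ)))
  have hpU : ∀ T, ∀ x ∈ T, x ∈ 𝒢 → p x ∈ U T := by
    intro T x hxT hx y hy
    rw [Finset.mem_coe, Finset.mem_sdiff] at hy
    exact hp x hx y (Finset.mem_coe.2 (Finset.mem_erase.2 ⟨fun h => hy.2 (h ▸ hxT), hy.1⟩))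
  have hU : Monotone U := fun S T hST =>
    Set.sInter_subset_sInter (Finset.coe_subset.2 (Finset.sdiff_subset_sdiff le_rfl hST))
  have hbig : b + 1 < 𝒢.card := by
    refine lt_of_le_of_lt ?_ hcard
    have hC : 1 ≤ (b + 1).choose 2 := Nat.choose_pos (by omega)
    have h2 : 2 ≤ ∑ j ∈ Finset.range (d + 2), ((b + 1).choose 2) ^ j := by
      calc 2 ≤ ∑ j ∈ Finset.range (d + 2), 1 := by simp
        _ ≤ _ := Finset.sum_le_sum fun j _ => Nat.one_le_pow _ _ hC
    nlinarith
  obtain ⟨v, B, hB, hvB, hBd, hvj⟩ := exists_blocks (b := b) (S := 𝒢)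
    (R := fun T x y => JoinedIn (U T) (p x) (p y)) (fun _ _ _ h => h.symm) (d + 2) (by
      intro T hT hTc
      have hne : (𝒢 \ T).Nonempty := by
        rw [← Finset.card_pos, Finset.card_sdiff_of_subset hT]
        omega
      obtain ⟨hf, hb'⟩ := hcomp (𝒢 \ T) (Finset.sdiff_subset.trans hsub) hne
      exact exists_joinedIn_of_card_zerothHomotopy_lt hf hb' (by omega)
        fun x hx => hpU T x hx (hT hx)) hcard
  have hBd' : ∀ i j, i ≠ j → Disjoint (B i) (B j) := fun i j hij =>
    hij.lt_or_gt.elim (hBd i j) fun h => (hBd j i h).symm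
  refine not_disjoint_acyclic_system (d := d) (V := Fin (d + 2 + 1)) (by simp)
    (G := fun σ => U (σ.biUnion B)) (p := fun i => p (v i))
    (fun σ τ h => hU (Finset.biUnion_subset_biUnion_of_subset_left B h))
    (fun i => hpU _ _ (by simpa using hvB i) (hB i (hvB i))) ?_ ?_ ?_
  · intro i j hij
    have key : ∀ i j, i < j → JoinedIn (U (({i, j} : Finset _).biUnion B)) (p (v i)) (p (v j)) := by
      intro i j hij
      obtain ⟨T, hT, h⟩ := hvj i j hij
      exact h.mono (hU (by simpa using hT))
    rcases hij.lt_or_gt with h | h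
    · exact key i j h
    · rw [Finset.pair_comm]
      exact (key j i h).symm
  · intro σ m h1 hm hσ
    obtain ⟨i, hi⟩ : ∃ i, i ∉ σ := by
      by_contra! h
      have : σ.card = d + 2 + 1 := by rw [Finset.eq_univ_of_forall h]; simp
      omega
    refine hhom (𝒢 \ σ.biUnion B) (Finset.sdiff_subset.trans hsub) ⟨v i, ?_⟩ m h1 hm
    rw [Finset.mem_sdiff, Finset.mem_biUnion]
    refine ⟨hB i (hvB i), ?_⟩
    rintro ⟨j, hj, hij⟩
    exact Finset.disjoint_left.1 (hBd' i j fun h => hi (h ▸ hj)) (hvB i) hij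
  · intro σ τ h
    rw [Set.disjoint_iff]
    rintro x ⟨hx, hx'⟩
    rw [← hem]
    intro y hy
    by_cases hyσ : y ∈ σ.biUnion B
    · refine hx' y (Finset.mem_coe.2 (Finset.mem_sdiff.2 ⟨hy, fun hyτ => ?_⟩))
      obtain ⟨i, hi, hyi⟩ := Finset.mem_biUnion.1 hyσ
      obtain ⟨j, hj, hyj⟩ := Finset.mem_biUnion.1 hyτ
      exact Finset.disjoint_left.1
        (hBd' i j fun hij => Finset.disjoint_left.1 h hi (hij ▸ hj)) hyi hyj
    · exact hx y (Finset.mem_coe.2 (Finset.mem_sdiff.2 ⟨hy, hyσ⟩))
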